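/- arXiv:0909.5097 — 5 statements merged into one kernel-verified Lean document; each statement's English description precedes it below -/
import Mathlib

section
/- Every structure A over a relational signature has an elementary extension M ⪰ A that is ω-saturated and has the homomorphism lifting property. -/
open FirstOrder FirstOrder.Language Cardinal

universe u v w

namespace PaperCSP

variable {L : FirstOrder.Language.{u, v}}

/-- Primitive positive bounded formulas: built from `⊥`, equalities and atomic relations
using conjunction and existential quantification. -/
inductive IsPP {α : Type w} : ∀ {n : ℕ}, L.BoundedFormula α n → Prop
  | falsum {n} : IsPP (BoundedFormula.falsum : L.BoundedFormula α n)
  | equal {n} (t₁ t₂ : L.Term (α ⊕ Fin n)) : IsPP (BoundedFormula.equal t₁ t₂)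
  | rel {n ℓ} (R : L.Relations ℓ) (ts : Fin ℓ → L.Term (α ⊕ Fin n)) :
      IsPP (BoundedFormula.rel R ts)
  | inf {n} {φ ψ : L.BoundedFormula α n} : IsPP φ → IsPP ψ → IsPP (φ ⊓ ψ)
  | ex {n} {φ : L.BoundedFormula α (n + 1)} : IsPP φ → IsPP φ.ex

/-- Existential positive bounded formulas: additionally closed under disjunction. -/
inductive IsEP {α : Type w} : ∀ {n : ℕ}, L.BoundedFormula α n → Prop
  | falsum {n} : IsEP (BoundedFormula.falsum : L.BoundedFormula α n)
  | equal {n} (t₁ t₂ : L.Term (α ⊕ Fin n)) : IsEP (BoundedFormula.equal t₁ t₂)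
  | rel {n ℓ} (R : L.Relations ℓ) (ts : Fin ℓ → L.Term (α ⊕ Fin n)) :
      IsEP (BoundedFormula.rel R ts)
  | inf {n} {φ ψ : L.BoundedFormula α n} : IsEP φ → IsEP ψ → IsEP (φ ⊓ ψ)
  | sup {n} {φ ψ : L.BoundedFormula α n} : IsEP φ → IsEP ψ → IsEP (φ ⊔ ψ)
  | ex {n} {φ : L.BoundedFormula α (n + 1)} : IsEP φ → IsEP φ.ex

/-- A relation is pp-definable (without parameters) in a structure. -/
def PPDefinable (L : FirstOrder.Language.{u, v}) (A : Type w) [L.Structure A] {m : ℕ} (R : Set ((Fin m) → A)) : Prop :=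
  ∃ φ : L.Formula (Fin m), IsPP φ ∧ R = {x | φ.Realize x}

/-- A relation is ep-definable (without parameters) in a structure. -/
def EPDefinable (L : FirstOrder.Language.{u, v}) (A : Type w) [L.Structure A] {m : ℕ} (R : Set ((Fin m) → A)) : Prop :=
  ∃ φ : L.Formula (Fin m), IsEP φ ∧ R = {x | φ.Realize x}

/-- A relation is first-order definable (without parameters) in a structure. -/
def FODefinable (L : FirstOrder.Language.{u, v}) (A : Type w) [L.Structure A] {m : ℕ} (R : Set ((Fin m) → A)) : Prop :=
  ∃ φ : L.Formula (Fin m), R = {x | φ.Realize x}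

/-- The direct power structure on `I → A`: relations hold iff they hold component-wise. -/
instance piStructure (I : Type*) (A : Type w) [L.Structure A] : L.Structure (I → A) where
  funMap f x i := Structure.funMap f fun j => x j i
  RelMap r x := ∀ i, Structure.RelMap r fun j => x j i

/-- An `m`-ary relation `R` on `A` is preserved by (invariant under) a function
`f : A^I → A` if it is preserved component-wise. -/
def Preserves {A : Type w} {I : Type*} (f : (I → A) → A)
    {m : ℕ} (R : Set (Fin m → A)) : Prop :=
  ∀ a : Fin m → I → A, (∀ i : I, (fun j => a j i) ∈ R) → (fun j => f (a j)) ∈ R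

/-- `R` is preserved by all ω-polymorphisms (homomorphisms `A^κ → A`, `κ ≤ ω`). -/
def PreservedByOmegaPolymorphisms (L : FirstOrder.Language.{u, v}) (A : Type w) [L.Structure A] {m : ℕ}
    (R : Set (Fin m → A)) : Prop :=
  ∀ (I : Type) [Countable I] (f : (I → A) →[L] A), Preserves (f : (I → A) → A) R

/-- The primitive positive theory of a structure: all true pp-sentences together with
the negations of all false pp-sentences. -/
def ppTheory (L : FirstOrder.Language.{u, v}) (A : Type w) [L.Structure A] : L.Theory :=
  {σ | IsPP σ ∧ A ⊨ σ} ∪ {σ | ∃ φ : L.Sentence, IsPP φ ∧ ¬A ⊨ φ ∧ σ = φ.not}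

/-- `A` is an existential-positively closed (epc) model of `T`. -/
def IsEPC (T : L.Theory) (A : Type w) [L.Structure A] : Prop :=
  A ⊨ T ∧ ∀ (B : Type w) [L.Structure B], B ⊨ T →
    ∀ (h : A →[L] B) (k : ℕ) (φ : L.Formula (Fin k)), IsPP φ →
      ∀ a : Fin k → A, φ.Realize (fun i => h (a i)) → φ.Realize a

/-- A structure is a core if every endomorphism is an embedding. -/
def IsCore (L : FirstOrder.Language.{u, v}) (A : Type w) [L.Structure A] : Prop :=
  ∀ h : A →[L] A, Function.Injective h ∧
    ∀ {n : ℕ} (r : L.Relations n) (x : Fin n → A),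
      Structure.RelMap r (fun i => h (x i)) → Structure.RelMap r x

/-- A set of formulas in `n` free variables is satisfiable together with the theory `T`. -/
def SatWith (T : L.Theory) {n : ℕ} (Φ : Set (L.Formula (Fin n))) : Prop :=
  ∃ (N : Type (max u v)) (S : L.Structure N), letI := S
    Nonempty N ∧ N ⊨ T ∧ ∃ b : Fin n → N, ∀ φ ∈ Φ, φ.Realize b

/-- A pp-`n`-type of a theory `T`. -/
def IsPPType (T : L.Theory) {n : ℕ} (p : Set (L.Formula (Fin n))) : Prop :=
  (∀ φ ∈ p, IsPP φ) ∧ SatWith T p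

/-- A maximal pp-`n`-type of a theory `T`. -/
def IsMaximalPPType (T : L.Theory) {n : ℕ} (p : Set (L.Formula (Fin n))) : Prop :=
  IsPPType T p ∧ ∀ φ : L.Formula (Fin n), IsPP φ → φ ∉ p → ¬SatWith T (insert φ p)

/-- `B` is pp-`κ`-saturated: over any set of fewer than `κ` parameters, every set of
pp-formulas in one free variable all of whose finite subsets are realised (i.e. every
pp-1-type of the expansion) is realised. -/
def IsPPSaturated (L : FirstOrder.Language.{u, v}) (κ : Cardinal.{w}) (B : Type w) [L.Structure B] : Prop :=
  ∀ (β : Type w), #β < κ → ∀ (v : β → B) (p : Set (L.Formula (β ⊕ Unit))),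
    (∀ φ ∈ p, IsPP φ) →
    (∀ s : Finset (L.Formula (β ⊕ Unit)), ↑s ⊆ p →
        ∃ c : B, ∀ φ ∈ s, Formula.Realize φ (Sum.elim v fun _ => c)) →
    ∃ c : B, ∀ φ ∈ p, Formula.Realize φ (Sum.elim v fun _ => c)

/-- `B` is `κ`-saturated: over any set of fewer than `κ` parameters, every set of
formulas in one free variable all of whose finite subsets are realised (i.e. every
1-type of the expansion) is realised. -/
def IsSaturated (L : FirstOrder.Language.{u, v}) (κ : Cardinal.{w}) (B : Type w) [L.Structure B] : Prop :=
  ∀ (β : Type w), #β < κ → ∀ (v : β → B) (p : Set (L.Formula (β ⊕ Unit))),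
    (∀ s : Finset (L.Formula (β ⊕ Unit)), ↑s ⊆ p →
        ∃ c : B, ∀ φ ∈ s, Formula.Realize φ (Sum.elim v fun _ => c)) →
    ∃ c : B, ∀ φ ∈ p, Formula.Realize φ (Sum.elim v fun _ => c)

/-- The homomorphism lifting property. -/
def HomLifting (L : FirstOrder.Language.{u, v}) (M : Type w) [L.Structure M] : Prop :=
  ∀ (k : ℕ) (a : Fin k → (ℕ → M)) (b : Fin k → M),
    (∀ φ : L.Formula (Fin k), IsPP φ →
        Formula.Realize (M := ℕ → M) φ a → Formula.Realize φ b) →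
    ∃ f : (ℕ → M) →[L] M, ∀ i, f (a i) = b i

/-- A function `f : A^α → A` is essentially unary. -/
def EssentiallyUnary {A : Type w} {α : Type*} (f : (α → A) → A) : Prop :=
  ∃ (β : α) (g : A → A), ∀ x : α → A, f x = g (x β)






/-- An atomic fact over a set `V` of names. -/
abbrev Fact (L : FirstOrder.Language.{u, v}) (V : Type*) := Σ n : ℕ, L.Relations n × (Fin n → V)

/-- The fact holds under an assignment. -/
def FactHolds {L : FirstOrder.Language.{u, v}} {V : Type*} {N : Type*} [L.Structure N]
    (h : V → N) (F : Fact L V) : Prop :=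
  Structure.RelMap F.2.1 (fun i => h (F.2.2 i))

theorem isPP_exs {L : FirstOrder.Language.{u, v}} {α : Type w} :
    ∀ {n : ℕ} {φ : L.BoundedFormula α n}, IsPP φ → IsPP φ.exs
  | 0, _, h => h
  | _ + 1, φ, h => isPP_exs (φ := φ.ex) (IsPP.ex h)

/-- Conjunction of a list of bounded formulas, with a trivial equality as base. -/
def conjPP {L : FirstOrder.Language.{u, v}} {α : Type w} {m : ℕ}
    (l : List (L.BoundedFormula α (m + 1))) : L.BoundedFormula α (m + 1) :=
  l.foldr (· ⊓ ·) (BoundedFormula.equal (Term.var (Sum.inr 0)) (Term.var (Sum.inr 0)))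

theorem isPP_conjPP {L : FirstOrder.Language.{u, v}} {α : Type w} {m : ℕ}
    (l : List (L.BoundedFormula α (m + 1))) (h : ∀ φ ∈ l, IsPP φ) : IsPP (conjPP l) := by
  induction l with
  | nil => exact IsPP.equal _ _
  | cons φ l ih =>
    exact IsPP.inf (h φ (by simp)) (ih fun ψ hψ => h ψ (by simp [hψ]))

theorem realize_conjPP {L : FirstOrder.Language.{u, v}} {α : Type w} {m : ℕ} {N : Type*}
    [L.Structure N] (l : List (L.BoundedFormula α (m + 1))) (v : α → N) (xs : Fin (m + 1) → N) :
    (conjPP l).Realize v xs ↔ ∀ φ ∈ l, φ.Realize v xs := by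
  induction l with
  | nil => simp [conjPP, BoundedFormula.Realize]
  | cons φ l ih =>
    have : conjPP (φ :: l) = φ ⊓ conjPP l := rfl
    rw [this, BoundedFormula.realize_inf, ih]
    simp

/-- The pp-formula of a finite set of facts. -/
def ppF {L : FirstOrder.Language.{u, v}} {V : Type*} {k m : ℕ} (idx : V → Fin (m + 1))
    (S : List (Fact L V)) (x : Fin k → V) : L.Formula (Fin k) :=
  (conjPP
    ((List.ofFn fun i : Fin k => (BoundedFormula.equal (Term.var (Sum.inl i))
        (Term.var (Sum.inr (idx (x i)))) : L.BoundedFormula (Fin k) (m + 1))) ++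
      S.map fun F => BoundedFormula.rel F.2.1 fun i => Term.var (Sum.inr (idx (F.2.2 i))))).exs

theorem isPP_ppF {L : FirstOrder.Language.{u, v}} {V : Type*} {k m : ℕ} (idx : V → Fin (m + 1))
    (S : List (Fact L V)) (x : Fin k → V) : IsPP (ppF idx S x) := by
  apply isPP_exs
  apply isPP_conjPP
  intro φ hφ
  rw [List.mem_append] at hφ
  rcases hφ with hφ | hφ
  · rw [List.mem_ofFn] at hφ
    obtain ⟨i, rfl⟩ := hφ
    exact IsPP.equal _ _
  · rw [List.mem_map] at hφ
    obtain ⟨F, _, rfl⟩ := hφ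
    exact IsPP.rel _ _

theorem realize_ppF {L : FirstOrder.Language.{u, v}} {V : Type*} {k m : ℕ} (idx : V → Fin (m + 1))
    (inv : Fin (m + 1) → V)
    (S : List (Fact L V)) (x : Fin k → V) (hx : ∀ i, inv (idx (x i)) = x i)
    (hS : ∀ F ∈ S, ∀ i, inv (idx (F.2.2 i)) = F.2.2 i) {N : Type*} [L.Structure N]
    (y : Fin k → N) :
    (ppF idx S x).Realize y ↔ ∃ h : V → N, (∀ i, h (x i) = y i) ∧ ∀ F ∈ S, FactHolds h F := by
  rw [ppF, BoundedFormula.realize_exs]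
  simp only [realize_conjPP, List.mem_append, List.mem_ofFn, List.mem_map]
  constructor
  · rintro ⟨ys, hys⟩
    refine ⟨fun v => ys (idx v), fun i => ?_, fun F hF => ?_⟩
    · have := hys _ (Or.inl ⟨i, rfl⟩)
      simpa [BoundedFormula.Realize] using this.symm
    · have := hys _ (Or.inr ⟨F, hF, rfl⟩)
      simpa [BoundedFormula.Realize, FactHolds] using this
  · rintro ⟨h, h1, h2⟩
    refine ⟨fun j => h (inv j), ?_⟩
    rintro φ (⟨i, rfl⟩ | ⟨F, hF, rfl⟩)
    · simp [BoundedFormula.Realize, hx, h1]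
    · have := h2 F hF
      simpa [BoundedFormula.Realize, FactHolds, hS F hF] using this

universe w₁ w₂

theorem exists_pp {L : FirstOrder.Language.{u, v}} {V : Type*} [Nonempty V]
    (S : List (Fact L V)) {k : ℕ} (x : Fin k → V) :
    ∃ φ : L.Formula (Fin k), IsPP φ ∧
      (∀ (N : Type w₁) [L.Structure N] (y : Fin k → N), φ.Realize y ↔
        ∃ h : V → N, (∀ i, h (x i) = y i) ∧ ∀ F ∈ S, FactHolds h F) ∧
      (∀ (N : Type w₂) [L.Structure N] (y : Fin k → N), φ.Realize y ↔
        ∃ h : V → N, (∀ i, h (x i) = y i) ∧ ∀ F ∈ S, FactHolds h F) := by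
  classical
  obtain ⟨v0⟩ := ‹Nonempty V›
  let A : Set V := Set.range x ∪ ⋃ F ∈ {F | F ∈ S}, Set.range F.2.2
  have hA : A.Finite := by
    refine (Set.finite_range x).union (Set.Finite.biUnion (List.finite_toSet S) ?_)
    intro F _
    exact Set.finite_range _
  have : ∃ (m : ℕ) (idx : V → Fin (m + 1)) (inv : Fin (m + 1) → V), ∀ a ∈ A, inv (idx a) = a := by
    have := hA.to_subtype
    obtain ⟨m, ⟨e⟩⟩ := Finite.exists_equiv_fin A
    refine ⟨m, fun a => if h : a ∈ A then (e ⟨a, h⟩).castSucc else 0,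
      fun j => if h : (j : ℕ) < m then (e.symm ⟨j, h⟩ : V) else v0, ?_⟩
    intro a ha
    simp [ha]
  obtain ⟨m, idx, inv, hinv⟩ := this
  have hx : ∀ i, inv (idx (x i)) = x i := fun i => hinv _ (Or.inl ⟨i, rfl⟩)
  have hS : ∀ F ∈ S, ∀ i, inv (idx (F.2.2 i)) = F.2.2 i := fun F hF i => by
    refine hinv _ (Or.inr ?_)
    simp only [Set.mem_iUnion]
    exact ⟨F, hF, i, rfl⟩
  exact ⟨ppF idx S x, isPP_ppF _ _ _, fun N _ y => realize_ppF idx inv S x hx hS y,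
    fun N _ y => realize_ppF idx inv S x hx hS y⟩

/-- Transfinite construction of a chain. -/
theorem exists_chain {P : Type*} {W : Type*} [LinearOrder W] [WellFoundedLT W] [Nonempty P]
    (R : W → P → P → Prop) (Φ : W → P → Prop)
    (h : ∀ (α : W) (G : W → P), (∀ β < α, Φ β (G β)) →
      (∀ β γ, β < γ → γ < α → R β (G β) (G γ)) →
      ∃ Q, Φ α Q ∧ ∀ β < α, R β (G β) Q) :
    ∃ G : W → P, (∀ α, Φ α (G α)) ∧ ∀ β γ, β < γ → R β (G β) (G γ) := by
  classical
  obtain ⟨p0⟩ := ‹Nonempty P›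
  let step : W → (W → P) → P := fun α G =>
    if hh : ∃ Q, Φ α Q ∧ ∀ β < α, R β (G β) Q then hh.choose else p0
  let G : W → P := (wellFounded_lt (α := W)).fix fun α rec =>
    step α (fun β => if hb : β < α then rec β hb else p0)
  have hG : ∀ α, G α = step α (fun β => if β < α then G β else p0) := by
    intro α
    have := (wellFounded_lt (α := W)).fix_eq (fun α (rec : ∀ β, β < α → P) =>
      step α (fun β => if hb : β < α then rec β hb else p0)) α
    exact this
  have key : ∀ α, Φ α (G α) ∧ ∀ β < α, R β (G β) (G α) := by
    intro α
    induction α using WellFoundedLT.induction with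
    | ind α ih =>
      obtain ⟨Q, hQ1, hQ2⟩ := h α G (fun β hβ => (ih β hβ).1)
        (fun β γ hβγ hγ => (ih γ hγ).2 β hβγ)
      have hh : ∃ Q, Φ α Q ∧ ∀ β < α, R β (if β < α then G β else p0) Q :=
        ⟨Q, hQ1, fun β hβ => by simpa [hβ] using hQ2 β hβ⟩
      have e : G α = hh.choose := by
        rw [hG]
        exact dif_pos hh
      have hs := hh.choose_spec
      rw [← e] at hs
      refine ⟨hs.1, fun β hβ => ?_⟩
      simpa [hβ] using hs.2 β hβ
  exact ⟨G, fun α => (key α).1, fun β γ hβγ => (key γ).2 β hβγ⟩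

/-- A long chain of elementary substructures, each realising the types over the previous ones. -/
structure GoodChain (L : FirstOrder.Language.{u, v}) (M : Type w) [L.Structure M]
    {W : Type*} [LinearOrder W] (S : W → Set M) : Prop where
  mono : ∀ β γ, β < γ → S β ⊆ S γ
  bdd : ∀ (ι : Type) [Countable ι] (s : ι → W), ∃ α, ∀ i, s i < α
  cover : ∀ x : M, ∃ α, x ∈ S α
  elem : ∀ α, ∃ (N : Type (w + 1)) (_ : L.Structure N) (e : N ↪ₑ[L] M), Set.range e = S α
  sat : ∀ α γ, α < γ → ∀ (B V : Type w) (b : B → M), (∀ x, b x ∈ S α) →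
    ∀ (i : V → (ℕ → M)), Function.Injective i → (∀ v n, i v n ∈ S α) →
    ∀ p : Set (L.Formula (B ⊕ V)),
      (∀ s : Finset (L.Formula (B ⊕ V)), ↑s ⊆ p → ∃ c : V → M, (∀ v, c v ∈ S α) ∧
        ∀ φ ∈ s, Formula.Realize φ (Sum.elim b c)) →
      ∃ c : V → M, (∀ v, c v ∈ S γ) ∧ ∀ φ ∈ p, Formula.Realize φ (Sum.elim b c)

/-- Finitely many facts true in the power can be copied along finite parts of `G`. -/
def GoodRel (L : FirstOrder.Language.{u, v}) (M : Type w) [L.Structure M]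
    (G : Set ((ℕ → M) × M)) : Prop :=
  ∀ l : List ((ℕ → M) × M), (∀ q ∈ l, q ∈ G) → ∀ F : List (Fact L (ℕ → M)),
    (∀ f ∈ F, FactHolds (id : (ℕ → M) → (ℕ → M)) f) →
    ∃ h : (ℕ → M) → M, (∀ q ∈ l, h q.1 = q.2) ∧ ∀ f ∈ F, FactHolds h f

theorem factHolds_comp {L : FirstOrder.Language.{u, v}} {V : Type*} {N : Type*} {M : Type*}
    [L.Structure N] [L.Structure M] (e : N ↪ₑ[L] M) (h : V → N) (f : Fact L V)
    (hf : FactHolds h f) : FactHolds (fun v => e (h v)) f :=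
  (e.map_rel f.2.1 fun i => h (f.2.2 i)).2 hf

theorem extend_goodRel {L : FirstOrder.Language.{u, v}} {M : Type w} [L.Structure M] [Nonempty M]
    {W : Type*} [LinearOrder W] [WellFoundedLT W] {S : W → Set M} (hS : GoodChain L M S)
    (α : W) (G : Set ((ℕ → M) × M)) (hG1 : ∀ q ∈ G, (∀ n, q.1 n ∈ S α) ∧ q.2 ∈ S α)
    (hG : GoodRel L M G) :
    ∃ c : (ℕ → M) → M, (∀ z, (∀ n, z n ∈ S α) → ∀ γ, α < γ → c z ∈ S γ) ∧
      (∀ q ∈ G, c q.1 = q.2) ∧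
      GoodRel L M {q | (∀ n, q.1 n ∈ S α) ∧ c q.1 = q.2} := by
  classical
  -- the least index above
  obtain ⟨γ, hαγ, hγ⟩ : ∃ γ, α < γ ∧ ∀ γ', α < γ' → γ ≤ γ' := by
    obtain ⟨δ, hδ⟩ := hS.bdd Unit (fun _ => α)
    have hne : {γ | α < γ}.Nonempty := ⟨δ, hδ ()⟩
    refine ⟨(wellFounded_lt (α := W)).min _ hne, (wellFounded_lt (α := W)).min_mem _ hne,
      fun γ' h' => not_lt.1 ((wellFounded_lt (α := W)).not_lt_min _ h')⟩
  let V := {z : ℕ → M // ∀ n, z n ∈ S α}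
  let Th : (k : ℕ) → List (Fact L (ℕ → M)) → (Fin k → V) → L.Formula (Fin k) := fun k F z =>
    (exists_pp.{u, v, w, w + 1, w} F (fun i => (z i : ℕ → M))).choose
  have hTh : ∀ k F (z : Fin k → V) (y : Fin k → M), (Th k F z).Realize y ↔
        ∃ h : (ℕ → M) → M, (∀ i, h (z i) = y i) ∧ ∀ f ∈ F, FactHolds h f := fun k F z y =>
    (exists_pp.{u, v, w, w + 1, w} F (fun i => (z i : ℕ → M))).choose_spec.2.1 M y
  let p1 : Set (L.Formula (S α ⊕ V)) := {ψ | ∃ (x : V) (y : S α), ((x : ℕ → M), (y : M)) ∈ G ∧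
    ψ = Term.equal (Term.var (Sum.inr x)) (Term.var (Sum.inl y))}
  let p2 : Set (L.Formula (S α ⊕ V)) := {ψ | ∃ (k : ℕ) (z : Fin k → V)
    (F : List (Fact L (ℕ → M))), (∀ f ∈ F, FactHolds (id : (ℕ → M) → (ℕ → M)) f) ∧
    ψ = (Th k F z).relabel (fun i => Sum.inr (z i))}
  have claim : ∀ s : Finset (L.Formula (S α ⊕ V)), ↑s ⊆ p1 ∪ p2 →
      ∃ (l : List ((ℕ → M) × M)) (F : List (Fact L (ℕ → M))), (∀ q ∈ l, q ∈ G) ∧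
        (∀ f ∈ F, FactHolds (id : (ℕ → M) → (ℕ → M)) f) ∧
        ∀ h : (ℕ → M) → M, (∀ q ∈ l, h q.1 = q.2) → (∀ f ∈ F, FactHolds h f) →
          ∀ ψ ∈ s, ψ.Realize (Sum.elim (fun y : S α => (y : M)) (fun x : V => h x)) := by
    intro s
    induction s using Finset.induction_on with
    | empty => exact fun _ => ⟨[], [], by simp⟩
    | insert ψ s _ ih =>
      intro hs
      obtain ⟨l, F, h1, h2, h3⟩ := ih (fun x hx => hs (by simp [Finset.mem_coe.1 hx]))
      rcases hs (show ψ ∈ _ by simp) with ⟨x, y, hxy, rfl⟩ | ⟨k, z, F', hF', rfl⟩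
      · refine ⟨((x : ℕ → M), (y : M)) :: l, F, ?_, h2, ?_⟩
        · intro q hq
          rcases List.mem_cons.1 hq with rfl | hq
          · exact hxy
          · exact h1 q hq
        · intro h ha hb ψ hψ
          rcases Finset.mem_insert.1 hψ with rfl | hψ
          · simpa [Formula.realize_equal] using ha _ (List.mem_cons_self)
          · exact h3 h (fun q hq => ha q (List.mem_cons_of_mem _ hq)) hb ψ hψ
      · refine ⟨l, F' ++ F, h1, ?_, ?_⟩
        · intro f hf
          rcases List.mem_append.1 hf with hf | hf
          · exact hF' f hf
          · exact h2 f hf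
        · intro h ha hb ψ hψ
          rcases Finset.mem_insert.1 hψ with rfl | hψ
          · rw [Formula.realize_relabel, hTh]
            exact ⟨h, fun i => rfl, fun f hf => hb f (List.mem_append_left _ hf)⟩
          · exact h3 h ha (fun f hf => hb f (List.mem_append_right _ hf)) ψ hψ
  obtain ⟨c, hc1, hc2⟩ := hS.sat α γ hαγ (S α) V (fun y => (y : M)) (fun y => y.2)
    (fun z => (z : ℕ → M)) Subtype.val_injective (fun z => z.2) (p1 ∪ p2) (by
      intro s hs
      obtain ⟨l, F, h1, h2, h3⟩ := claim s hs
      obtain ⟨h0, h01, h02⟩ := hG l h1 F h2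
      obtain ⟨N, _, e, he⟩ := hS.elem α
      obtain ⟨φ, -, hφ1, hφ2⟩ := exists_pp.{u, v, w, w + 1, w} F (fun i : Fin l.length => (l.get i).1)
      have hy : ∀ i : Fin l.length, ∃ y : N, e y = (l.get i).2 := by
        intro i
        have : (l.get i).2 ∈ S α := (hG1 _ (h1 _ (List.get_mem l i))).2
        rw [← he] at this
        exact this
      choose y hy using hy
      have r1 : φ.Realize (e ∘ y) := by
        rw [hφ1]
        exact ⟨h0, fun i => (h01 _ (List.get_mem l i)).trans (hy i).symm, h02⟩
      rw [e.map_formula, hφ2] at r1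
      obtain ⟨h', h'1, h'2⟩ := r1
      refine ⟨fun x => e (h' x), fun v => he.subset ⟨_, rfl⟩, ?_⟩
      refine h3 (fun x => e (h' x)) ?_ (fun f hf => factHolds_comp e h' f (h'2 f hf))
      intro q hq
      obtain ⟨i, rfl⟩ := List.get_of_mem hq
      rw [h'1, hy])
  let c' : (ℕ → M) → M := fun z => if hz : ∀ n, z n ∈ S α then c ⟨z, hz⟩ else z 0
  have hc' : ∀ z : V, c' z = c z := fun z => by
    simp only [c']
    rw [dif_pos z.2]
  refine ⟨c', ?_, ?_, ?_⟩
  · intro z hz γ' hγ'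
    rw [hc' ⟨z, hz⟩]
    rcases (hγ γ' hγ').eq_or_lt with rfl | h
    · exact hc1 _
    · exact hS.mono _ _ h (hc1 _)
  · rintro ⟨x, y⟩ hq
    have := hc2 _ (Or.inl ⟨⟨x, (hG1 _ hq).1⟩, ⟨y, (hG1 _ hq).2⟩, hq, rfl⟩)
    rw [hc' ⟨x, (hG1 _ hq).1⟩]
    simpa [Formula.realize_equal] using this
  · intro l hl F hF
    let z : Fin l.length → V := fun i => ⟨(l.get i).1, (hl _ (List.get_mem l i)).1⟩
    have := hc2 _ (Or.inr ⟨l.length, z, F, hF, rfl⟩)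
    rw [Formula.realize_relabel, hTh] at this
    obtain ⟨h, h1, h2⟩ := this
    refine ⟨h, ?_, h2⟩
    intro q hq
    obtain ⟨i, rfl⟩ := List.get_of_mem hq
    refine (h1 i).trans ?_
    rw [← (hl _ (List.get_mem l i)).2]
    exact (hc' (z i)).symm

theorem homLifting_of_goodChain {L : FirstOrder.Language.{u, v}} [L.IsRelational]
    {M : Type w} [L.Structure M] [Nonempty M]
    {W : Type*} [LinearOrder W] [WellFoundedLT W] {S : W → Set M} (hS : GoodChain L M S) :
    HomLifting L M := by
  classical
  have mono' : ∀ β γ, β ≤ γ → S β ⊆ S γ := fun β γ h => by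
    rcases h.eq_or_lt with rfl | h
    · exact le_rfl
    · exact hS.mono _ _ h
  intro k a b hab
  obtain ⟨α0, hα0a, hα0b⟩ : ∃ α0, (∀ i n, a i n ∈ S α0) ∧ ∀ i, b i ∈ S α0 := by
    choose rk hrk using hS.cover
    obtain ⟨α1, h1⟩ := hS.bdd (Fin k × ℕ) (fun q => rk (a q.1 q.2))
    obtain ⟨α2, h2⟩ := hS.bdd (Fin k) (fun q => rk (b q))
    exact ⟨max α1 α2, fun i n => mono' _ _ ((h1 (i, n)).le.trans (le_max_left _ _)) (hrk _),
      fun i => mono' _ _ ((h2 i).le.trans (le_max_right _ _)) (hrk _)⟩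
  let W' := {α : W // α0 ≤ α}
  obtain ⟨c, hc1, hc2⟩ := exists_chain (P := (ℕ → M) → M) (W := W')
    (fun β c c' => ∀ z : ℕ → M, (∀ n, z n ∈ S β.1) → c' z = c z)
    (fun α c => (∀ z, (∀ n, z n ∈ S α.1) → ∀ γ, α.1 < γ → c z ∈ S γ) ∧
      (∀ i, c (a i) = b i) ∧ GoodRel L M {q | (∀ n, q.1 n ∈ S α.1) ∧ c q.1 = q.2}) (by
      intro α G hG hR
      let Gr : Set ((ℕ → M) × M) := {q | (∃ i, q = (a i, b i)) ∨
        ∃ β < α, (∀ n, q.1 n ∈ S β.1) ∧ G β q.1 = q.2}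
      have hgood : GoodRel L M Gr := by
        by_cases hβ0 : ∃ β, β < α
        · obtain ⟨β0, hβ0⟩ := hβ0
          intro l hl
          have : ∃ β < α, ∀ q ∈ l, (∀ n, q.1 n ∈ S β.1) ∧ G β q.1 = q.2 := by
            induction l with
            | nil => exact ⟨β0, hβ0, by simp⟩
            | cons q l ih =>
              obtain ⟨β, hβ, hl'⟩ := ih (fun q hq => hl q (List.mem_cons_of_mem _ hq))
              obtain ⟨β', hβ', hq⟩ : ∃ β < α, (∀ n, q.1 n ∈ S β.1) ∧ G β q.1 = q.2 := by
                rcases hl q List.mem_cons_self with ⟨i, rfl⟩ | h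
                · exact ⟨β0, hβ0, fun n => mono' _ _ β0.2 (hα0a i n), (hG β0 hβ0).2.1 i⟩
                · exact h
              rcases lt_trichotomy β β' with h | rfl | h
              · refine ⟨β', hβ', ?_⟩
                intro q' hq'
                rcases List.mem_cons.1 hq' with rfl | hq'
                · exact hq
                · obtain ⟨h1, h2⟩ := hl' q' hq'
                  exact ⟨fun n => hS.mono _ _ h (h1 n), by rw [hR β β' h hβ' _ h1, h2]⟩
              · refine ⟨β, hβ, ?_⟩
                intro q' hq'
                rcases List.mem_cons.1 hq' with rfl | hq'
                · exact hq
                · exact hl' q' hq'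
              · refine ⟨β, hβ, ?_⟩
                intro q' hq'
                rcases List.mem_cons.1 hq' with rfl | hq'
                · exact ⟨fun n => hS.mono _ _ h (hq.1 n), by rw [hR β' β h hβ _ hq.1, hq.2]⟩
                · exact hl' q' hq'
          obtain ⟨β, hβ, hl'⟩ := this
          exact (hG β hβ).2.2 l hl'
        · intro l hl F hF
          obtain ⟨φ, hpp, hφ, -⟩ := exists_pp.{u, v, w, w, w} F a
          have h1 := hab φ hpp (by
            rw [hφ]
            exact ⟨id, fun i => rfl, hF⟩)
          rw [hφ] at h1
          obtain ⟨h, h1, h2⟩ := h1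
          refine ⟨h, ?_, h2⟩
          intro q hq
          rcases hl q hq with ⟨i, rfl⟩ | ⟨β, hβ, _⟩
          · exact h1 i
          · exact absurd ⟨β, hβ⟩ hβ0
      obtain ⟨c, h1, h2, h3⟩ := extend_goodRel hS α.1 Gr (by
        rintro q (⟨i, rfl⟩ | ⟨β, hβ, hq1, hq2⟩)
        · exact ⟨fun n => mono' _ _ α.2 (hα0a i n), mono' _ _ α.2 (hα0b i)⟩
        · refine ⟨fun n => hS.mono _ _ hβ (hq1 n), ?_⟩
          rw [← hq2]
          exact (hG β hβ).1 _ hq1 _ hβ) hgood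
      exact ⟨c, ⟨h1, fun i => h2 (a i, b i) (Or.inl ⟨i, rfl⟩), h3⟩,
        fun β hβ z hz => h2 (z, G β z) (Or.inr ⟨β, hβ, hz, rfl⟩)⟩)
  have hr : ∀ z : ℕ → M, ∃ α : W', ∀ n, z n ∈ S α.1 := by
    intro z
    choose rk hrk using hS.cover
    obtain ⟨α1, h1⟩ := hS.bdd ℕ (fun q => rk (z q))
    exact ⟨⟨max α0 α1, le_max_left _ _⟩,
      fun n => mono' _ _ ((h1 n).le.trans (le_max_right _ _)) (hrk _)⟩
  choose rk hrk using hr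
  have hf : ∀ (z : ℕ → M) (α : W'), (∀ n, z n ∈ S α.1) → c α z = c (rk z) z := by
    intro z α hz
    rcases lt_trichotomy α (rk z) with h | h | h
    · exact (hc2 _ _ h z hz).symm
    · rw [h]
    · exact hc2 _ _ h z (hrk z)
  refine ⟨⟨fun z => c (rk z) z, fun f => isEmptyElim f, ?_⟩, fun i => (hc1 _).2.1 i⟩
  intro n r x hx
  obtain ⟨α1, h1⟩ := hS.bdd (Fin n) (fun i => (rk (x i)).1)
  let α : W' := ⟨max α0 α1, le_max_left _ _⟩
  have hα : ∀ i m, x i m ∈ S α.1 := fun i m =>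
    mono' _ _ ((h1 i).le.trans (le_max_right _ _)) (hrk (x i) m)
  obtain ⟨h, h2, h3⟩ := (hc1 α).2.2 (List.ofFn fun i => (x i, c α (x i))) (by
    intro q hq
    rw [List.mem_ofFn] at hq
    obtain ⟨i, rfl⟩ := hq
    exact ⟨hα i, rfl⟩) [⟨n, r, x⟩] (by
    intro f hf
    rw [List.mem_singleton] at hf
    subst hf
    exact hx)
  have h4 : Structure.RelMap r (fun i => h (x i)) := h3 ⟨n, r, x⟩ (by simp)
  have h5 : ∀ i, h (x i) = c (rk (x i)) (x i) := fun i => by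
    rw [← hf (x i) α (hα i)]
    exact h2 (x i, c α (x i)) (List.mem_ofFn.2 ⟨i, rfl⟩)
  simp only [h5] at h4
  exact h4

theorem isSaturated_of_goodChain {L : FirstOrder.Language.{u, v}}
    {M : Type w} [L.Structure M] [Nonempty M]
    {W : Type*} [LinearOrder W] [WellFoundedLT W] {S : W → Set M} (hS : GoodChain L M S) :
    IsSaturated L (ℵ₀ : Cardinal.{w}) M := by
  classical
  intro β hβ v p hp
  have hfin : Finite β := Cardinal.lt_aleph0_iff_finite.1 hβ
  obtain ⟨α, hα⟩ : ∃ α, ∀ x, v x ∈ S α := by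
    choose rk hrk using hS.cover
    obtain ⟨n, ⟨en⟩⟩ := Finite.exists_equiv_fin β
    obtain ⟨α, hα⟩ := hS.bdd (Fin n) (fun i => rk (v (en.symm i)))
    refine ⟨α, fun x => ?_⟩
    have := hα (en x)
    rw [en.symm_apply_apply] at this
    exact hS.mono _ _ this (hrk _)
  obtain ⟨γ, hγ⟩ := hS.bdd Unit (fun _ => α)
  obtain ⟨N, _, e, he⟩ := hS.elem α
  have hv : ∀ x, ∃ y, e y = v x := fun x => by
    have := hα x
    rw [← he] at this
    exact this
  choose v' hv' using hv
  have hv'' : v = e ∘ v' := funext fun x => (hv' x).symm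
  let g : β ⊕ Unit → β ⊕ PUnit.{w + 1} := Sum.map id (fun _ => PUnit.unit)
  have hNe : Nonempty N := by
    obtain ⟨c, -⟩ := hp ∅ (by simp)
    have : (∃ x : M, x = x) := ⟨c, rfl⟩
    obtain ⟨d⟩ : Nonempty N := by
      have hh := e.elementarilyEquivalent
      exact (hh.nonempty_iff).2 ⟨c⟩
    exact ⟨d⟩
  obtain ⟨d⟩ := hNe
  have hg : ∀ (φ : L.Formula (β ⊕ Unit)) (c : PUnit.{w + 1} → M),
      (φ.relabel g).Realize (Sum.elim v c) ↔ φ.Realize (Sum.elim v fun _ => c PUnit.unit) := by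
    intro φ c
    rw [Formula.realize_relabel]
    have : Sum.elim v c ∘ g = Sum.elim v fun _ => c PUnit.unit := by
      ext (x | x) <;> rfl
    rw [this]
  obtain ⟨c, -, hc⟩ := hS.sat α γ (hγ ()) β PUnit v hα (fun _ _ => e d)
    (fun _ _ _ => rfl) (fun _ _ => by rw [← he]; exact ⟨_, rfl⟩)
    ((fun φ => Formula.relabel g φ) '' p) (by
      intro s hs
      obtain ⟨s0, hs0, rfl⟩ := Finset.subset_set_image_iff.1 hs
      obtain ⟨c, hc⟩ := hp s0 hs0
      let θ : L.Formula (β ⊕ Unit) := Formula.iInf (fun φ : s0 => (φ : L.Formula (β ⊕ Unit)))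
      have h1 : (θ.iExs Unit).Realize (e ∘ v') := by
        rw [Formula.realize_iExs]
        refine ⟨fun _ => c, ?_⟩
        rw [Formula.realize_iInf]
        rintro ⟨φ, hφ⟩
        rw [← hv'']
        exact hc φ hφ
      rw [e.map_formula, Formula.realize_iExs] at h1
      obtain ⟨c', hc'⟩ := h1
      rw [Formula.realize_iInf] at hc'
      refine ⟨fun _ => e (c' ()), fun _ => by rw [← he]; exact ⟨_, rfl⟩, ?_⟩
      intro ψ hψ
      obtain ⟨φ, hφ, rfl⟩ := Finset.mem_image.1 hψ
      rw [hg]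
      have h2 := hc' ⟨φ, hφ⟩
      rw [← e.map_formula] at h2
      convert h2 using 1
      ext (x | x)
      · simp [hv']
      · rfl)
  refine ⟨c PUnit.unit, fun φ hφ => ?_⟩
  rw [← hg]
  exact hc _ ⟨φ, hφ, rfl⟩

/-- `N'` realises, via `e`, the (infinitary) types that are finitely satisfiable in `N`. -/
def SatVia {L : FirstOrder.Language.{u, v}} {N N' : Type*} [L.Structure N] [L.Structure N']
    (e : N ↪ₑ[L] N') : Prop :=
  ∀ (B V : Type w) (b : B → N) (i : V → (ℕ → N)), Function.Injective i →
    ∀ p : Set (L.Formula (B ⊕ V)),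
      (∀ s : Finset (L.Formula (B ⊕ V)), ↑s ⊆ p → ∃ c : V → N,
        ∀ φ ∈ s, Formula.Realize φ (Sum.elim b c)) →
      ∃ c : V → N', ∀ φ ∈ p, Formula.Realize φ (Sum.elim (fun x => e (b x)) c)

/-- Realising all types by a suitable ultrapower. -/
theorem exists_ultrapower {L : FirstOrder.Language.{u, v}} (N : Type (w + 1)) [L.Structure N]
    [Nonempty N] [Small.{w} N] :
    ∃ (N' : Type (w + 1)) (_ : L.Structure N') (e : N ↪ₑ[L] N'), Small.{w} N' ∧
      SatVia.{u, v, w} e := by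
  classical
  let X := Set ((ℕ → N) → N)
  let I := Finset X
  let U : Ultrafilter I := Ultrafilter.of Filter.atTop
  have hI : Small.{w} I := small_of_injective (β := Set X) (f := fun s => (s : Set X))
    Finset.coe_injective
  have hU : ∀ x : X, ∀ᶠ s in (U : Filter I), x ∈ s := by
    intro x
    apply (Ultrafilter.of_le (Filter.atTop : Filter I))
    refine Filter.mem_of_superset (Filter.mem_atTop ({x} : Finset X)) ?_
    intro s hs
    exact hs (Finset.mem_singleton_self x)
  let N' := (U : Filter I).Product (fun _ => N)
  let mk : (I → N) → N' := fun x => (x : (U : Filter I).Product (fun _ => N))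
  have los : ∀ {β : Type w} (φ : L.Formula β) (x : β → I → N),
      φ.Realize (fun i => mk (x i)) ↔ ∀ᶠ s in (U : Filter I), φ.Realize (fun i => x i s) :=
    fun φ x => Ultraproduct.realize_formula_cast φ x
  let e : N ↪ₑ[L] N' := ⟨fun x => mk (fun _ => x), by
    intro n φ x
    refine (Ultraproduct.realize_formula_cast (M := fun _ : I => N) (u := U) φ (fun i _ => x i)).trans ?_
    exact Filter.eventually_const⟩
  refine ⟨N', inferInstance, e, ?_, ?_⟩
  · exact small_quotient _
  · intro B V b i hi p hp
    let D : L.Formula (B ⊕ V) → X := fun φ => {c | φ.Realize (Sum.elim b (fun v => c (i v)))}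
    have h1 : ∀ s : I, ∃ c : V → N, ∀ φ ∈ p, D φ ∈ s → φ.Realize (Sum.elim b c) := by
      intro s
      have hs : (↑(s.filter (· ∈ D '' p)) : Set X) ⊆ D '' p := by
        intro x hx
        exact (Finset.mem_filter.1 (Finset.mem_coe.1 hx)).2
      obtain ⟨F, hF, hFs⟩ := Finset.subset_set_image_iff.1 hs
      obtain ⟨c, hc⟩ := hp F hF
      refine ⟨c, fun φ hφ hDs => ?_⟩
      have h2 : D φ ∈ s.filter (· ∈ D '' p) := Finset.mem_filter.2 ⟨hDs, φ, hφ, rfl⟩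
      rw [← hFs] at h2
      obtain ⟨ψ, hψ, hψφ⟩ := Finset.mem_image.1 h2
      let c' : (ℕ → N) → N := Function.extend i c (fun z => z 0)
      have hc' : (fun v => c' (i v)) = c := funext fun v => hi.extend_apply c _ v
      have h3 : c' ∈ D ψ := by
        change ψ.Realize (Sum.elim b (fun v => c' (i v)))
        rw [hc']
        exact hc ψ hψ
      rw [hψφ] at h3
      change φ.Realize (Sum.elim b (fun v => c' (i v))) at h3
      rwa [hc'] at h3
    choose c hc using h1
    refine ⟨fun v => mk (fun s => c s v), fun φ hφ => ?_⟩
    have h4 := (los φ (Sum.elim (fun x _ => b x) (fun v s => c s v))).2 (by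
      filter_upwards [hU (D φ)] with s hs
      convert hc s φ hφ hs using 1
      ext (x | x) <;> rfl)
    convert h4 using 1
    ext (x | x) <;> rfl

/-- A structure with carrier a set of ordinals. -/
structure PS (L : FirstOrder.Language.{u, v}) where
  /-- carrier -/
  D : Set Ordinal.{w}
  /-- relations -/
  rel : ∀ n, L.Relations n → (Fin n → Ordinal.{w}) → Prop

instance {L : FirstOrder.Language.{u, v}} [L.IsRelational] (P : PS.{u, v, w} L) :
    L.Structure P.D where
  funMap f := isEmptyElim f
  RelMap r x := P.rel _ r (fun i => (x i : Ordinal))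

theorem transport {L : FirstOrder.Language.{u, v}} [L.IsRelational] (D : Set Ordinal.{w})
    [Small.{w} D] (N : Type (w + 1)) [L.Structure N] [Small.{w} N] (e : D → N)
    (he : Function.Injective e) :
    ∃ (Q : PS.{u, v, w} L) (g : N ≃[L] Q.D), Small.{w} Q.D ∧
      ∀ d : D, (g (e d) : Ordinal) = d := by
  classical
  obtain ⟨B, hB⟩ := Ordinal.bddAbove_of_small (s := D)
  obtain ⟨code⟩ : Nonempty (Shrink.{w} N ↪ Ordinal.{w}) :=
    ⟨(nonempty_embedding_to_cardinal (α := Shrink.{w} N)).some.trans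
      ⟨Cardinal.ord, Cardinal.ord_injective⟩⟩
  let j : N → Ordinal.{w} := fun n =>
    if h : ∃ d, e d = n then (h.choose : Ordinal) else Order.succ B + code (equivShrink N n)
  have hje : ∀ d, j (e d) = d := by
    intro d
    have h : ∃ d', e d' = e d := ⟨d, rfl⟩
    simp only [j]
    rw [dif_pos h, he h.choose_spec]
  have hjo : ∀ n, (¬ ∃ d, e d = n) → j n = Order.succ B + code (equivShrink N n) := by
    intro n hn
    simp only [j]
    rw [dif_neg hn]
  have hlt : ∀ (d : D) (o : Ordinal), (d : Ordinal) ≠ Order.succ B + o := by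
    intro d o h
    have h1 : (d : Ordinal) ≤ B := hB d.2
    have h2 : Order.succ B ≤ Order.succ B + o := le_self_add
    rw [← h] at h2
    exact absurd (h2.trans h1) (not_le.2 (Order.lt_succ B))
  have hj : Function.Injective j := by
    intro m n hmn
    by_cases hm : ∃ d, e d = m <;> by_cases hn : ∃ d, e d = n
    · obtain ⟨d, rfl⟩ := hm
      obtain ⟨d', rfl⟩ := hn
      rw [hje, hje] at hmn
      rw [Subtype.ext hmn]
    · obtain ⟨d, rfl⟩ := hm
      rw [hje, hjo n hn] at hmn
      exact absurd hmn (hlt _ _)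
    · obtain ⟨d, rfl⟩ := hn
      rw [hje, hjo m hm] at hmn
      exact absurd hmn.symm (hlt _ _)
    · rw [hjo m hm, hjo n hn] at hmn
      have := code.injective (add_left_cancel hmn)
      exact (equivShrink N).injective this
  obtain ⟨Q, hQD, hQr⟩ : ∃ Q : PS.{u, v, w} L, Q.D = Set.range j ∧
      ∀ n (r : L.Relations n) x, Q.rel n r x ↔ ∃ y : Fin n → N,
        (∀ i, x i = j (y i)) ∧ Structure.RelMap r y :=
    ⟨⟨Set.range j, fun n r x => ∃ y : Fin n → N,
      (∀ i, x i = j (y i)) ∧ Structure.RelMap r y⟩, rfl, fun _ _ _ => Iff.rfl⟩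
  let g : N ≃[L] Q.D :=
    { (Equiv.ofInjective j hj).trans (Equiv.setCongr hQD.symm) with
      map_fun' := fun f => isEmptyElim f
      map_rel' := by
        intro n r x
        refine (hQr n r _).trans ?_
        constructor
        · rintro ⟨y, hy, hr⟩
          have : x = y := funext fun i => hj (hy i)
          rw [this]
          exact hr
        · intro h
          exact ⟨x, fun i => rfl, h⟩ }
  have hsm : Small.{w} Q.D := by
    rw [hQD]
    exact small_range j
  exact ⟨Q, g, hsm, hje⟩

/-- elementary inclusion -/
def PS.Le {L : FirstOrder.Language.{u, v}} [L.IsRelational] (P Q : PS.{u, v, w} L) : Prop :=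
  ∃ e : P.D ↪ₑ[L] Q.D, ∀ x, (e x : Ordinal) = x

/-- elementary inclusion realising types -/
def PS.Sat {L : FirstOrder.Language.{u, v}} [L.IsRelational] (P Q : PS.{u, v, w} L) : Prop :=
  ∃ e : P.D ↪ₑ[L] Q.D, (∀ x, (e x : Ordinal) = x) ∧ SatVia.{u, v, w} e

theorem PS.Sat.le {L : FirstOrder.Language.{u, v}} [L.IsRelational] {P Q : PS.{u, v, w} L}
    (h : P.Sat Q) : P.Le Q := ⟨h.choose, h.choose_spec.1⟩

theorem PS.exists_sat {L : FirstOrder.Language.{u, v}} [L.IsRelational] (P : PS.{u, v, w} L)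
    [Nonempty P.D] [Small.{w} P.D] : ∃ Q : PS.{u, v, w} L, Small.{w} Q.D ∧ P.Sat Q := by
  obtain ⟨N', _, e, _, hs⟩ := exists_ultrapower.{u, v, w} (L := L) P.D
  obtain ⟨Q, g, hQ, hg⟩ := transport (L := L) P.D N' e e.injective
  refine ⟨Q, hQ, g.toElementaryEmbedding.comp e, fun x => hg x, ?_⟩
  intro B V b i hi p hp
  obtain ⟨c, hc⟩ := hs B V b i hi p hp
  refine ⟨fun v => g (c v), fun φ hφ => ?_⟩
  have := (g.toElementaryEmbedding.map_formula φ _).2 (hc φ hφ)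
  convert this using 1
  ext (x | x) <;> rfl

theorem PS.Le.trans_sat {L : FirstOrder.Language.{u, v}} [L.IsRelational]
    {P U Q : PS.{u, v, w} L} (h1 : P.Le U) (h2 : U.Sat Q) : P.Sat Q := by
  obtain ⟨e, he⟩ := h1
  obtain ⟨f, hf, hs⟩ := h2
  refine ⟨f.comp e, fun x => (hf _).trans (he x), ?_⟩
  intro B V b i hi p hp
  refine hs B V (fun x => e (b x)) (fun v n => e (i v n)) ?_ p ?_
  · intro v v' h
    exact hi (funext fun n => e.injective (congrFun h n))
  · intro s hsp
    obtain ⟨c, hc⟩ := hp s hsp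
    refine ⟨fun v => e (c v), fun φ hφ => ?_⟩
    have := (e.map_formula φ _).2 (hc φ hφ)
    convert this using 1
    ext (x | x) <;> rfl

/-- Elementarity for bounded formulas, with assignments of ordinals. -/
theorem PS.le_bounded {L : FirstOrder.Language.{u, v}} [L.IsRelational]
    {P Q : PS.{u, v, w} L} (h : P.Le Q) {α : Type} {n : ℕ} (φ : L.BoundedFormula α n)
    (x : α → P.D) (y : Fin n → P.D) (x' : α → Q.D) (y' : Fin n → Q.D)
    (hx : ∀ i, (x' i : Ordinal) = x i) (hy : ∀ i, (y' i : Ordinal) = y i) :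
    φ.Realize x' y' ↔ φ.Realize x y := by
  obtain ⟨e, he⟩ := h
  have h1 : x' = e ∘ x := funext fun i => Subtype.ext ((hx i).trans (he _).symm)
  have h2 : y' = e ∘ y := funext fun i => Subtype.ext ((hy i).trans (he _).symm)
  rw [h1, h2]
  exact e.map_boundedFormula φ x y

theorem term_var {L : FirstOrder.Language.{u, v}} [L.IsRelational] {α : Type*} (t : L.Term α) :
    ∃ a, t = Term.var a := by
  cases t with
  | var a => exact ⟨a, rfl⟩
  | func f _ => exact isEmptyElim f

theorem PS.exists_union {L : FirstOrder.Language.{u, v}} [L.IsRelational]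
    {ι : Type*} [LinearOrder ι] [Nonempty ι] [Small.{w} ι] (G : ι → PS.{u, v, w} L)
    (hs : ∀ i, Small.{w} (G i).D) (hG : ∀ i j, i < j → (G i).Le (G j)) :
    ∃ Q : PS.{u, v, w} L, Small.{w} Q.D ∧ Q.D = ⋃ i, (G i).D ∧ ∀ i, (G i).Le Q := by
  classical
  have hG' : ∀ i j, i ≤ j → (G i).Le (G j) := by
    intro i j h
    rcases h.eq_or_lt with rfl | h
    · exact ⟨ElementaryEmbedding.refl L _, fun _ => rfl⟩
    · exact hG i j h
  have hsub : ∀ i j, i ≤ j → (G i).D ⊆ (G j).D := by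
    intro i j h x hx
    obtain ⟨e, he⟩ := hG' i j h
    have := (e ⟨x, hx⟩).2
    rwa [he] at this
  obtain ⟨Q, hQD, hQr⟩ : ∃ Q : PS.{u, v, w} L, Q.D = (⋃ i, (G i).D) ∧
      ∀ n (r : L.Relations n) x, Q.rel n r x ↔ ∃ i, (∀ k, x k ∈ (G i).D) ∧ (G i).rel n r x :=
    ⟨⟨⋃ i, (G i).D, fun n r x => ∃ i, (∀ k, x k ∈ (G i).D) ∧
      (G i).rel n r x⟩, rfl, fun _ _ _ => Iff.rfl⟩
  have hmem : ∀ x, x ∈ Q.D ↔ ∃ i, x ∈ (G i).D := fun x => by rw [hQD, Set.mem_iUnion]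
  have hrel : ∀ i n (r : L.Relations n) (x : Fin n → (G i).D),
      Q.rel n r (fun k => (x k : Ordinal)) ↔ (G i).rel n r (fun k => (x k : Ordinal)) := by
    intro i n r x
    rw [hQr]
    constructor
    · rintro ⟨j, hj, hr⟩
      rcases le_total i j with h | h
      · obtain ⟨e, he⟩ := hG' i j h
        have := (e.map_rel r x).1 (by
          change (G j).rel n r _
          have h2 : (fun k => (((e ∘ x) k : (G j).D) : Ordinal)) = fun k => (x k : Ordinal) :=
            funext fun k => he (x k)
          rw [h2]
          exact hr)
        exact this
      · obtain ⟨e, he⟩ := hG' j i h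
        have := (e.map_rel r (fun k => ⟨x k, hj k⟩)).2 hr
        change (G i).rel n r (fun k => ((e ⟨x k, hj k⟩ : (G i).D) : Ordinal)) at this
        simpa only [he] using this
    · intro h
      exact ⟨i, fun k => (x k).2, h⟩
  have key : ∀ {α : Type} {n : ℕ} (φ : L.BoundedFormula α n) (i : ι)
      (x : α → (G i).D) (y : Fin n → (G i).D) (x' : α → Q.D) (y' : Fin n → Q.D)
      (hx : ∀ i, (x' i : Ordinal) = x i) (hy : ∀ i, (y' i : Ordinal) = y i),
      φ.Realize x' y' ↔ φ.Realize x y := by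
    intro α n φ
    induction φ with
    | falsum => intros; exact Iff.rfl
    | equal t₁ t₂ =>
      intro i x y x' y' hx hy
      have hv : ∀ a, ((Sum.elim x' y' a : Q.D) : Ordinal) = (Sum.elim x y a : (G i).D) := by
        rintro (a | a)
        · exact hx a
        · exact hy a
      obtain ⟨a, rfl⟩ := term_var t₁
      obtain ⟨b, rfl⟩ := term_var t₂
      change Sum.elim x' y' a = Sum.elim x' y' b ↔ Sum.elim x y a = Sum.elim x y b
      rw [Subtype.ext_iff, Subtype.ext_iff, hv, hv]
    | rel r ts =>
      intro i x y x' y' hx hy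
      have hv : ∀ a, ((Sum.elim x' y' a : Q.D) : Ordinal) = (Sum.elim x y a : (G i).D) := by
        rintro (a | a)
        · exact hx a
        · exact hy a
      have ht : ∀ k, (((ts k).realize (Sum.elim x' y') : Q.D) : Ordinal) =
          ((ts k).realize (Sum.elim x y) : (G i).D) := by
        intro k
        obtain ⟨a, ha⟩ := term_var (ts k)
        rw [ha]
        exact hv a
      change Q.rel _ r (fun k => (((ts k).realize (Sum.elim x' y') : Q.D) : Ordinal)) ↔ _
      simp only [ht]
      exact hrel i _ r _
    | imp φ ψ h1 h2 =>
      intro i x y x' y' hx hy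
      exact imp_congr (h1 i x y x' y' hx hy) (h2 i x y x' y' hx hy)
    | all φ ih =>
      intro i x y x' y' hx hy
      have hsn : ∀ {n : ℕ} {D D' : Set Ordinal.{w}} (y : Fin n → D) (y' : Fin n → D') (a : D)
          (a' : D'), (∀ i, (y' i : Ordinal) = y i) → (a' : Ordinal) = a →
          ∀ k, ((Fin.snoc (α := fun _ => D') y' a' k : D') : Ordinal) =
            (Fin.snoc (α := fun _ => D) y a k : D) := by
        intro n D D' y y' a a' h1 h2 k
        refine Fin.lastCases ?_ (fun k => ?_) k
        · simp only [Fin.snoc_last]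
          exact h2
        · simp only [Fin.snoc_castSucc]
          exact h1 k
      constructor
      · intro h a
        have ha : (a : Ordinal) ∈ Q.D := (hmem _).2 ⟨i, a.2⟩
        exact (ih i x (Fin.snoc y a) x' (Fin.snoc y' ⟨a, ha⟩) hx
          (hsn y y' a ⟨a, ha⟩ hy rfl)).1 (h ⟨a, ha⟩)
      · intro h a
        obtain ⟨j, hj⟩ := (hmem _).1 a.2
        have hij : i ≤ max i j := le_max_left _ _
        obtain ⟨e, he⟩ := hG' i _ hij
        have h3 := (PS.le_bounded (hG' i _ hij) φ.all x y (fun k => e (x k)) (fun k => e (y k))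
          (fun k => he _) (fun k => he _)).2 h
        have h4 := h3 ⟨a, hsub j _ (le_max_right _ _) hj⟩
        refine (ih (max i j) _ _ x' (Fin.snoc y' a) ?_ ?_).2 h4
        · intro k
          rw [hx, he]
        · refine hsn _ _ _ _ ?_ rfl
          intro k
          rw [hy, he]
  refine ⟨Q, by rw [hQD]; exact small_iUnion _, hQD, fun i => ?_⟩
  refine ⟨⟨fun x => ⟨x, (hmem _).2 ⟨i, x.2⟩⟩, ?_⟩, fun x => rfl⟩
  intro n φ x
  exact key φ i x default _ default (fun _ => rfl) (fun k => k.elim0)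

theorem bdd_omega_one (ι : Type) [Countable ι] (s : ι → Set.Iio (Ordinal.omega.{w} 1)) :
    ∃ α, ∀ i, s i < α := by
  have h := Ordinal.iSup_lt_omega_one (f := fun i => (s i : Ordinal.{w})) (fun i => (s i).2)
  refine ⟨⟨Order.succ (⨆ i, (s i : Ordinal.{w})), (Cardinal.isSuccLimit_omega 1).succ_lt h⟩, ?_⟩
  intro i
  change (s i : Ordinal.{w}) < _
  exact Order.lt_succ_iff.2 (Ordinal.le_iSup (fun i => (s i : Ordinal.{w})) i)

theorem exists_goodChain {L : FirstOrder.Language.{u, v}} [L.IsRelational]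
    (A : Type w) [L.Structure A] [Nonempty A] :
    ∃ (M : Type w) (_ : L.Structure M)
      (S : Set.Iio (Ordinal.omega.{w} 1) → Set M),
      Nonempty (A ↪ₑ[L] M) ∧ GoodChain L M S := by
  classical
  let W := Set.Iio (Ordinal.omega.{w} 1)
  have hPn : Nonempty (PS.{u, v, w} L) := ⟨⟨∅, fun _ _ _ => False⟩⟩
  have hWs : Small.{w} W := Ordinal.small_Iio _
  obtain ⟨G, hG1, hG2⟩ := exists_chain (P := PS.{u, v, w} L) (W := W)
    (fun _ P Q => P.Sat Q) (fun _ Q => Small.{w} Q.D ∧ Nonempty (A ↪ₑ[L] Q.D)) (by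
      intro α G h1 h2
      by_cases hα : ∃ β, β < α
      · have : Nonempty (Set.Iio α) := ⟨⟨hα.choose, hα.choose_spec⟩⟩
        obtain ⟨U, hUs, -, hU⟩ := PS.exists_union (ι := Set.Iio α) (fun β => G β.1)
          (fun β => (h1 β.1 β.2).1) (fun β γ h => (h2 β.1 γ.1 h γ.2).le)
        obtain ⟨β, hβ⟩ := hα
        obtain ⟨e⟩ := (h1 β hβ).2
        obtain ⟨f, -⟩ := hU ⟨β, hβ⟩
        have : Nonempty U.D := Nonempty.map (fun a => f (e a)) inferInstance
        obtain ⟨Q, hQs, hQ⟩ := U.exists_sat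
        obtain ⟨g, -⟩ := hQ.le
        exact ⟨Q, ⟨hQs, ⟨(g.comp f).comp e⟩⟩, fun β hβ => (hU ⟨β, hβ⟩).trans_sat hQ⟩
      · let _ : L.Structure (ULift.{w + 1} A) := Equiv.inducedStructure Equiv.ulift.symm
        let g0 : A ≃[L] ULift.{w + 1} A := Equiv.inducedStructureEquiv Equiv.ulift.symm
        obtain ⟨Q, g, hQs, -⟩ := transport (L := L) (∅ : Set Ordinal.{w}) (ULift.{w + 1} A)
          (fun x => x.2.elim) (fun x => x.2.elim)
        exact ⟨Q, ⟨hQs, ⟨g.toElementaryEmbedding.comp g0.toElementaryEmbedding⟩⟩,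
          fun β hβ => absurd ⟨β, hβ⟩ hα⟩)
  obtain ⟨α0, -⟩ := bdd_omega_one.{w} Empty (fun x => x.elim)
  have hWn : Nonempty W := ⟨α0⟩
  obtain ⟨U, hUs, hUD, hU⟩ := PS.exists_union (ι := W) G (fun α => (hG1 α).1)
    (fun β γ h => (hG2 β γ h).le)
  choose f hf using hU
  let _ : L.Structure (Shrink.{w} U.D) := Equiv.inducedStructure (equivShrink U.D)
  let σ : U.D ≃[L] Shrink.{w} U.D := Equiv.inducedStructureEquiv (equivShrink U.D)
  let e : ∀ α, (G α).D ↪ₑ[L] Shrink.{w} U.D := fun α => σ.toElementaryEmbedding.comp (f α)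
  have hcomp : ∀ β γ (x : (G β).D) (y : (G γ).D), (x : Ordinal) = y → e β x = e γ y := by
    intro β γ x y h
    change σ (f β x) = σ (f γ y)
    rw [Subtype.ext ((hf β x).trans (h.trans (hf γ y).symm))]
  refine ⟨Shrink.{w} U.D, inferInstance, fun α => Set.range (e α),
    (hG1 α0).2.map (fun g => (e α0).comp g), ?_⟩
  refine ⟨?_, bdd_omega_one.{w}, ?_, fun α => ⟨_, inferInstance, e α, rfl⟩, ?_⟩
  · rintro β γ h _ ⟨x, rfl⟩
    obtain ⟨g, hg⟩ := (hG2 β γ h).le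
    exact ⟨g x, hcomp _ _ _ _ (hg x)⟩
  · intro x
    obtain ⟨y, rfl⟩ := σ.surjective x
    obtain ⟨α, hα⟩ := Set.mem_iUnion.1 (hUD.subset y.2)
    refine ⟨α, ⟨y, hα⟩, ?_⟩
    change σ (f α _) = σ y
    rw [Subtype.ext (hf α ⟨y, hα⟩)]
  · intro α γ h B V b hb i hi hiS p hp
    obtain ⟨g, hg, hsat⟩ := hG2 α γ h
    choose b' hb' using hb
    choose i' hi' using hiS
    obtain ⟨c, hc⟩ := hsat B V b' i' (by
      intro v v' hvv
      apply hi
      funext n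
      rw [← hi', ← hi', hvv]) p (by
      intro s hs
      obtain ⟨c, hc1, hc2⟩ := hp s hs
      choose c' hc' using hc1
      refine ⟨c', fun φ hφ => ?_⟩
      rw [← (e α).map_formula]
      convert hc2 φ hφ using 1
      ext1 x
      rcases x with x | x
      · exact hb' x
      · exact hc' x)
    refine ⟨fun v => e γ (c v), fun v => ⟨_, rfl⟩, fun φ hφ => ?_⟩
    have := ((e γ).map_formula φ _).2 (hc φ hφ)
    convert this using 1
    ext1 x
    rcases x with x | x
    · exact (hb' x).symm.trans (hcomp _ _ _ _ (hg _).symm)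
    · rfl

/-- Every structure has an elementary extension that is `ω`-saturated
and has the homomorphism lifting property. -/
theorem exists_monster_extension {L : FirstOrder.Language.{u, v}} [L.IsRelational]
    (A : Type w) [L.Structure A] :
    ∃ (M : Type w) (S : L.Structure M), letI := S
      Nonempty (A ↪ₑ[L] M) ∧ IsSaturated L (ℵ₀ : Cardinal.{w}) M ∧ HomLifting L M := by
  classical
  rcases isEmpty_or_nonempty A with hA | hA
  · refine ⟨A, inferInstance, ⟨ElementaryEmbedding.refl L A⟩, ?_, ?_⟩
    · intro β _ x p hp
      obtain ⟨c, -⟩ := hp ∅ (by simp)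
      exact isEmptyElim c
    · intro k a b _
      have hE : IsEmpty (ℕ → A) := ⟨fun z => isEmptyElim (z 0)⟩
      refine ⟨⟨fun z => isEmptyElim z, fun f => isEmptyElim f, ?_⟩, fun i => isEmptyElim (b i)⟩
      intro n r x hx
      have h0 := hx 0
      convert h0 using 1
  · obtain ⟨M, S, C, ⟨e⟩, hC⟩ := exists_goodChain (L := L) A
    have hM : Nonempty M := hA.map e
    exact ⟨M, S, ⟨e⟩, isSaturated_of_goodChain hC, homLifting_of_goodChain hC⟩

end PaperCSP
end

section
/- For every relational structure A: the 4-ary relation {(x,y,u,v) ∈ A⁴ : x = y or u = v} is pp-definable in A without parameters if and only if every relation that is existential-positive definable in A without parameters is pp-definable in A without parameters (i.e., ⟨A⟩_pp = ⟨A⟩_ep). -/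
open FirstOrder FirstOrder.Language Cardinal

universe u v w

namespace PaperCSP

variable {L : FirstOrder.Language.{u, v}}

section Helpers

theorem IsPP.isEP {α : Type*} {n : ℕ} {φ : L.BoundedFormula α n} (h : IsPP φ) : IsEP φ := by
  induction h with
  | falsum => exact .falsum
  | equal t₁ t₂ => exact .equal t₁ t₂
  | rel R ts => exact .rel R ts
  | inf _ _ h₁ h₂ => exact .inf h₁ h₂
  | ex _ h => exact .ex h

theorem IsPP.castLE {α : Type*} {n : ℕ} {φ : L.BoundedFormula α n} (h : IsPP φ) :
    ∀ {k : ℕ} (hk : n ≤ k), IsPP (φ.castLE hk) := by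
  induction h with
  | falsum => intro k hk; exact .falsum
  | equal t₁ t₂ => intro k hk; exact .equal _ _
  | rel R ts => intro k hk; exact .rel R _
  | inf _ _ h₁ h₂ => intro k hk; exact .inf (h₁ hk) (h₂ hk)
  | ex _ h => intro k hk; exact .ex (h (add_le_add_left hk 1))

theorem IsPP.relabel {α β : Type*} {m n : ℕ} (g : α → β ⊕ Fin m) {φ : L.BoundedFormula α n}
    (h : IsPP φ) : IsPP (φ.relabel g) := by
  induction h with
  | falsum => exact .falsum
  | equal t₁ t₂ => exact .equal _ _
  | rel R ts => exact .rel R _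
  | inf _ _ h₁ h₂ => exact .inf h₁ h₂
  | ex _ h => rw [BoundedFormula.relabel_ex]; exact .ex h

theorem IsPP.exs {α : Type*} : ∀ {n : ℕ} {φ : L.BoundedFormula α n}, IsPP φ → IsPP φ.exs
  | 0, _, h => h
  | _ + 1, φ, h => IsPP.exs (φ := φ.ex) (IsPP.ex h)

/-- pp-definability over an arbitrary index type. -/
def PPD (L : FirstOrder.Language.{u, v}) (A : Type w) [L.Structure A] {γ : Type}
    (S : Set (γ → A)) : Prop :=
  ∃ φ : L.Formula γ, IsPP φ ∧ ∀ x, x ∈ S ↔ φ.Realize x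

variable {A : Type w} [L.Structure A] {γ δ : Type}

theorem PPD.inter {S T : Set (γ → A)} (hS : PPD L A S) (hT : PPD L A T) : PPD L A (S ∩ T) := by
  obtain ⟨φ, hφ, h₁⟩ := hS
  obtain ⟨ψ, hψ, h₂⟩ := hT
  exact ⟨φ ⊓ ψ, .inf hφ hψ, fun x => by simp [h₁, h₂]⟩

theorem PPD.reindex {S : Set (γ → A)} (hS : PPD L A S) (f : γ → δ) :
    PPD L A {x : δ → A | x ∘ f ∈ S} := by
  obtain ⟨φ, hφ, h₁⟩ := hS
  exact ⟨φ.relabel f, IsPP.relabel _ hφ, fun x => by simp [h₁, Formula.realize_relabel]⟩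

theorem PPD.proj [Finite δ] {S : Set (γ ⊕ δ → A)} (hS : PPD L A S) :
    PPD L A {x : γ → A | ∃ y : δ → A, Sum.elim x y ∈ S} := by
  obtain ⟨φ, hφ, h₁⟩ := hS
  refine ⟨φ.iExs δ, IsPP.exs (IsPP.relabel _ hφ), fun x => ?_⟩
  simp [h₁, Formula.realize_iExs]

theorem PPD.interFinset {ι : Type} {S : Set (γ → A)} (hS : PPD L A S) (T : ι → Set (γ → A))
    (hT : ∀ i, PPD L A (T i)) (s : Finset ι) : PPD L A (S ∩ {x | ∀ i ∈ s, x ∈ T i}) := by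
  classical
  induction s using Finset.induction_on with
  | empty => simpa using hS
  | insert a s _ ih =>
    have := ih.inter (hT a)
    convert this using 1
    ext x
    simp only [Set.mem_inter_iff, Set.mem_ofPred_eq, Finset.mem_insert, forall_eq_or_imp]
    tauto

theorem PPD.union [Finite γ]
    (hE : PPD L A {t : Fin 4 → A | t 0 = t 1 ∨ t 2 = t 3})
    {S T : Set (γ → A)} (hS : PPD L A S) (hT : PPD L A T) : PPD L A (S ∪ T) := by
  classical
  rcases S.eq_empty_or_nonempty with rfl | ⟨a, ha⟩
  · simpa using hT
  rcases T.eq_empty_or_nonempty with rfl | ⟨b, hb⟩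
  · simpa using hS
  have := Fintype.ofFinite γ
  have h₁ := hS.reindex (δ := γ ⊕ (γ ⊕ γ)) (fun i => .inr (.inl i))
  have h₂ := hT.reindex (δ := γ ⊕ (γ ⊕ γ)) (fun i => .inr (.inr i))
  have h₃ := ((h₁.inter h₂).interFinset (ι := γ × γ) _
    (fun p => hE.reindex (δ := γ ⊕ (γ ⊕ γ))
      ![.inl p.1, .inr (.inl p.1), .inl p.2, .inr (.inr p.2)]) Finset.univ).proj
  convert h₃ using 1
  ext x
  simp only [Set.mem_union, Set.mem_ofPred_eq, Set.mem_inter_iff, Finset.mem_univ, true_imp_iff]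
  constructor
  · rintro (h | h)
    · refine ⟨Sum.elim x b, ⟨h, hb⟩, fun p => .inl ?_⟩
      simp
    · refine ⟨Sum.elim a x, ⟨ha, h⟩, fun p => .inr ?_⟩
      simp
  · rintro ⟨y, ⟨hy₁, hy₂⟩, h⟩
    by_cases hx : ∀ i, x i = y (.inl i)
    · left
      convert hy₁ using 1
      funext i
      exact hx i
    · right
      push Not at hx
      obtain ⟨i, hi⟩ := hx
      convert hy₂ using 1
      funext j
      have := h (i, j)
      simp at this
      exact this.resolve_left hi

theorem IsEP.ppd (hE : PPD L A {t : Fin 4 → A | t 0 = t 1 ∨ t 2 = t 3}) [Finite γ] {n : ℕ}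
    {φ : L.BoundedFormula γ n} (h : IsEP φ) :
    PPD L A {x : γ ⊕ Fin n → A | φ.Realize (x ∘ Sum.inl) (x ∘ Sum.inr)} := by
  induction h with
  | falsum => exact ⟨⊥, .falsum, fun x => Iff.rfl⟩
  | equal t₁ t₂ =>
    refine ⟨Term.equal t₁ t₂, .equal _ _, fun x => ?_⟩
    rw [Formula.realize_equal]
    simp [BoundedFormula.Realize]
  | rel R ts =>
    refine ⟨R.formula ts, .rel _ _, fun x => ?_⟩
    rw [Formula.realize_rel]
    simp [BoundedFormula.Realize]
  | inf _ _ h₁ h₂ =>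
    convert h₁.inter h₂ using 1
    ext x
    simp
  | sup _ _ h₁ h₂ =>
    convert PPD.union hE h₁ h₂ using 1
    ext x
    simp
  | @ex n φ _ h =>
    have h' := (h.reindex (δ := (γ ⊕ Fin n) ⊕ Unit)
      (Sum.elim (fun i => .inl (.inl i))
        (Fin.snoc (α := fun _ => (γ ⊕ Fin n) ⊕ Unit) (fun i => .inl (.inr i)) (.inr ())))).proj
    convert h' using 1
    ext x
    simp only [Set.mem_ofPred_eq, BoundedFormula.realize_ex]
    have key : ∀ a : A, ∀ y : Unit → A, y () = a →
      ((Sum.elim x y ∘ (Sum.elim (fun i => .inl (.inl i))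
        (Fin.snoc (α := fun _ => (γ ⊕ Fin n) ⊕ Unit) (fun i => .inl (.inr i)) (.inr ())))) ∘
          Sum.inr) = (Fin.snoc (x ∘ Sum.inr) a : Fin (n + 1) → A) := by
      rintro a y rfl
      funext i
      refine Fin.lastCases ?_ (fun i => ?_) i <;> simp
    constructor
    · rintro ⟨a, ha⟩
      refine ⟨fun _ => a, ?_⟩
      rw [key a _ rfl]
      exact ha
    · rintro ⟨y, hy⟩
      rw [key _ y rfl] at hy
      exact ⟨_, hy⟩

theorem ppDefinable_iff_ppd {m : ℕ} (R : Set (Fin m → A)) : PPDefinable L A R ↔ PPD L A R := by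
  simp only [PPDefinable, PPD, Set.ext_iff, Set.mem_ofPred_eq]

end Helpers

/-- The relation `{(x,y,u,v) : x = y ∨ u = v}` is pp-definable in `A`
iff every ep-definable relation of `A` is pp-definable, i.e. `⟨A⟩_pp = ⟨A⟩_ep`. -/
theorem pp_eq_ep_iff {L : FirstOrder.Language.{u, v}} [L.IsRelational]
    (A : Type w) [L.Structure A] :
    PPDefinable L A {t : Fin 4 → A | t 0 = t 1 ∨ t 2 = t 3} ↔
      ∀ (m : ℕ) (R : Set (Fin m → A)), PPDefinable L A R ↔ EPDefinable L A R := by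
  constructor
  · intro hE m R
    rw [ppDefinable_iff_ppd] at hE
    constructor
    · rintro ⟨φ, hφ, h⟩
      exact ⟨φ, hφ.isEP, h⟩
    · rintro ⟨φ, hφ, h⟩
      rw [ppDefinable_iff_ppd]
      have h' := (IsEP.ppd hE hφ).reindex (δ := Fin m) (Sum.elim id Fin.elim0)
      convert h' using 1
      rw [h]
      ext x
      simp only [Set.mem_ofPred_eq, Formula.Realize]
      rw [Subsingleton.elim (default : Fin 0 → A)]
      rfl
  · intro h
    rw [h]
    refine ⟨(Term.equal (Term.var 0) (Term.var 1) : L.Formula (Fin 4)) ⊔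
      Term.equal (Term.var 2) (Term.var 3), .sup (.equal _ _) (.equal _ _), ?_⟩
    ext x
    simp [Formula.realize_sup, Formula.realize_equal]


end PaperCSP
end

section
/- Consider the relational structure Q = (ℚ; R₊, R₁, R_≠), where R₊ = {(x,y,z) ∈ ℚ³ : x + y = z}, R₁ = {1}, and R_≠ = {(x,y) ∈ ℚ² : x ≠ y}. Then every ω-polymorphism of Q is a projection: for every κ ≤ ω and every homomorphism f : Q^κ → Q there exists an index i < κ such that f(x̄) = x_i for all x̄ ∈ ℚ^κ. -/
open FirstOrder FirstOrder.Language Cardinal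

universe u v w

namespace PaperCSP

variable {L : FirstOrder.Language.{u, v}}

/-- The signature with a ternary relation (for `+`), a unary relation (for `1`) and a
binary relation (for `≠`). -/
inductive QRel : ℕ → Type
  | plus : QRel 3
  | one : QRel 1
  | ne : QRel 2

/-- The relational language of `(ℚ; +, 1, ≠)`. -/
def QLang : FirstOrder.Language := ⟨fun _ => Empty, QRel⟩

/-- The structure `(ℚ; R₊, R₁, R_≠)`. -/
instance : QLang.Structure ℚ where
  funMap := fun f _ => f.elim
  RelMap := fun {n} r => match r with
    | .plus => fun x => x 0 + x 1 = x 2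
    | .one => fun x => x 0 = 1
    | .ne => fun x => x 0 ≠ x 1


/-- Every `ω`-polymorphism of `(ℚ; R₊, R₁, R_≠)` is a projection. -/
theorem omega_polymorphisms_of_qPlusOneNe_are_projections
    (I : Type) [Countable I] (f : (I → ℚ) →[QLang] ℚ) :
    ∃ i : I, ∀ x : I → ℚ, f x = x i := by
  classical
  have hadd : ∀ x y : I → ℚ, f (x + y) = f x + f y := by
    intro x y
    have h := f.map_rel (QRel.plus : QLang.Relations 3) ![x, y, x + y] (fun i => rfl)
    exact h.symm
  have hone : f (fun _ => 1) = 1 :=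
    f.map_rel (QRel.one : QLang.Relations 1) ![fun _ => 1] (fun i => rfl)
  have hne : ∀ x y : I → ℚ, (∀ i, x i ≠ y i) → f x ≠ f y := by
    intro x y hxy
    exact f.map_rel (QRel.ne : QLang.Relations 2) ![x, y] (fun i => hxy i)
  let F : (I → ℚ) →+ ℚ := AddMonoidHom.mk' f hadd
  have hsmul : ∀ (c : ℚ) (x : I → ℚ), f (c • x) = c * f x := fun c x => map_rat_smul F c x
  have hconst : ∀ c : ℚ, f (fun _ => c) = c := by
    intro c
    have h := hsmul c (fun _ => 1)
    rw [hone, mul_one] at h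
    have h2 : (c • (fun _ => 1 : I → ℚ)) = fun _ => c := by
      funext i
      simp
    rwa [h2] at h
  have hrange : ∀ x : I → ℚ, ∃ i, x i = f x := by
    intro x
    by_contra! h
    exact hne x (fun _ => f x) h (hconst _).symm
  obtain ⟨e, he⟩ := exists_injective_nat I
  obtain ⟨i, hi⟩ := hrange (fun j => (e j : ℚ))
  have hchi : f (Pi.single i 1) = 1 := by
    have h1 : f (Pi.single i 1) ≠ 0 := by
      intro h0
      have h2 : f ((fun j => (e j : ℚ)) + Pi.single i 1) = e i := by
        rw [hadd, h0, ← hi, add_zero]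
      refine hne ((fun j => (e j : ℚ)) + Pi.single i 1) (fun _ => (e i : ℚ)) ?_
        (h2.trans (hconst _).symm)
      intro j
      by_cases hj : j = i
      · subst hj; simp
      · simpa [hj] using fun h => hj (he h)
    obtain ⟨j, hj⟩ := hrange (Pi.single i 1)
    by_cases hji : j = i
    · subst hji; rw [← hj]; simp
    · rw [Pi.single_eq_of_ne hji] at hj
      exact absurd hj.symm h1
  have hmiss : ∀ (h : I → ℚ) (m : ℚ), h i = 0 → (∀ j, h j ≠ m) → f h = 0 := by
    intro h m h0 hm
    obtain ⟨j, hj⟩ := hrange (h + (m - f h) • Pi.single i 1)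
    rw [hadd, hsmul, hchi] at hj
    by_cases hji : j = i
    · subst hji
      simp [h0] at hj
      linarith
    · simp [hji] at hj
      exact absurd hj (hm j)
  have hzero : ∀ h : I → ℚ, h i = 0 → f h = 0 := by
    intro h h0
    have hs : h = (fun j => max (h j) 0) + (fun j => min (h j) 0) := by
      funext j
      simp [max_add_min]
    rw [hs, hadd, hmiss _ (-1) (by simp [h0]), hmiss _ 1 (by simp [h0]), add_zero]
    · intro j hj
      have := min_le_right (h j) 0
      linarith
    · intro j hj
      have := le_max_right (h j) 0
      linarith
  refine ⟨i, fun x => ?_⟩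
  have hx : x = (fun j => x j - x i) + (fun _ => x i) := by
    funext j
    simp
  conv_lhs => rw [hx]
  rw [hadd, hzero _ (by simp), hconst, zero_add]

end PaperCSP
end

section
/- Consider the relational structure A = (ℚ; U₁, U₂, S₂), where U₁ = {x ∈ ℚ : x = 1}, U₂ = {x ∈ ℚ : x < 0}, and S₂ = {(x,y) ∈ ℚ² : 2x < y and 0 < y ≤ 1}. Let φ(x₁,…,x_k) be any pp-formula in this signature, suppose A ⊨ φ(a₁,…,a_k), and let λ₁,…,λ_j list exactly those indices i with a_i = 0. Then there exists ε > 0 such that for all δ with 0 ≤ δ ≤ ε, the tuple obtained from (a₁,…,a_k) by replacing each entry a_{λ₁},…,a_{λ_j} by δ also satisfies φ in A. -/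
open FirstOrder FirstOrder.Language Cardinal

universe u v w

namespace PaperCSP

variable {L : FirstOrder.Language.{u, v}}

/-- The signature with two unary relations and one binary relation. -/
inductive ARel : ℕ → Type
  | u1 : ARel 1
  | u2 : ARel 1
  | s2 : ARel 2

/-- The relational language of `(ℚ; U₁, U₂, S₂)`. -/
def ALang : FirstOrder.Language := ⟨fun _ => Empty, ARel⟩

/-- The structure `(ℚ; U₁, U₂, S₂)` with `U₁ = {1}`, `U₂ = {x : x < 0}` and
`S₂ = {(x,y) : 2x < y ∧ 0 < y ≤ 1}`. -/
instance : ALang.Structure ℚ where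
  funMap := fun f _ => f.elim
  RelMap := fun {n} r => match r with
    | .u1 => fun x => x 0 = 1
    | .u2 => fun x => x 0 < 0
    | .s2 => fun x => 2 * x 0 < x 1 ∧ 0 < x 1 ∧ x 1 ≤ 1


/-- Replace zero by `δ`. -/
def zeroPert (δ x : ℚ) : ℚ := if x = 0 then δ else x

lemma zeroPert_term {β : Type*} (δ : ℚ) (t : ALang.Term β) (v : β → ℚ) :
    t.realize (fun i => zeroPert δ (v i)) = zeroPert δ (t.realize v) := by
  cases t with
  | var i => rfl
  | func f ts => exact Empty.elim f

lemma zeroPert_elim {α : Type*} {n : ℕ} (δ : ℚ) (v : α → ℚ) (xs : Fin n → ℚ) :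
    Sum.elim (fun i => zeroPert δ (v i)) (fun i => zeroPert δ (xs i)) =
      fun i => zeroPert δ (Sum.elim v xs i) := by
  funext i
  cases i <;> rfl

lemma zeroPert_rel {l : ℕ} (R : ALang.Relations l) (x : Fin l → ℚ)
    (h : Structure.RelMap R x) :
    ∃ ε : ℚ, 0 < ε ∧ ∀ δ : ℚ, 0 ≤ δ → δ ≤ ε →
      Structure.RelMap R (fun i => zeroPert δ (x i)) := by
  cases R with
  | u1 =>
    refine ⟨1, one_pos, fun δ _ _ => ?_⟩
    change x 0 = 1 at h
    change zeroPert δ (x 0) = 1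
    simp [zeroPert, h]
  | u2 =>
    refine ⟨1, one_pos, fun δ _ _ => ?_⟩
    change x 0 < 0 at h
    change zeroPert δ (x 0) < 0
    simp [zeroPert, h, h.ne]
  | s2 =>
    change 2 * x 0 < x 1 ∧ 0 < x 1 ∧ x 1 ≤ 1 at h
    obtain ⟨h1, h2, h3⟩ := h
    refine ⟨x 1 / 4, by linarith, fun δ _ hd => ?_⟩
    change 2 * zeroPert δ (x 0) < zeroPert δ (x 1) ∧ 0 < zeroPert δ (x 1) ∧ zeroPert δ (x 1) ≤ 1
    have e : zeroPert δ (x 1) = x 1 := by simp [zeroPert, h2.ne']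
    rw [e]
    refine ⟨?_, h2, h3⟩
    unfold zeroPert
    split_ifs <;> linarith

lemma zeroPert_bounded {α : Type*} {n : ℕ} {φ : ALang.BoundedFormula α n} (hφ : IsPP φ)
    (v : α → ℚ) (xs : Fin n → ℚ) (h : φ.Realize v xs) :
    ∃ ε : ℚ, 0 < ε ∧ ∀ δ : ℚ, 0 ≤ δ → δ ≤ ε →
      φ.Realize (fun i => zeroPert δ (v i)) (fun i => zeroPert δ (xs i)) := by
  induction hφ with
  | falsum => exact h.elim
  | equal t₁ t₂ =>
    refine ⟨1, one_pos, fun δ _ _ => ?_⟩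
    simp only [BoundedFormula.Realize] at h ⊢
    rw [zeroPert_elim, zeroPert_term, zeroPert_term, h]
  | rel R ts =>
    simp only [BoundedFormula.Realize] at h ⊢
    obtain ⟨ε, h0, h1⟩ := zeroPert_rel R _ h
    refine ⟨ε, h0, fun δ hd hd' => ?_⟩
    simp only [zeroPert_elim, zeroPert_term]
    exact h1 δ hd hd'
  | inf _ _ ih1 ih2 =>
    rw [BoundedFormula.realize_inf] at h
    obtain ⟨e1, p1, q1⟩ := ih1 xs h.1
    obtain ⟨e2, p2, q2⟩ := ih2 xs h.2
    refine ⟨min e1 e2, lt_min p1 p2, fun δ hd hd' => ?_⟩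
    rw [BoundedFormula.realize_inf]
    exact ⟨q1 δ hd (hd'.trans (min_le_left _ _)), q2 δ hd (hd'.trans (min_le_right _ _))⟩
  | ex _ ih =>
    rw [BoundedFormula.realize_ex] at h
    obtain ⟨b, hb⟩ := h
    obtain ⟨e, p, q⟩ := ih _ hb
    refine ⟨e, p, fun δ hd hd' => ?_⟩
    rw [BoundedFormula.realize_ex]
    refine ⟨zeroPert δ b, ?_⟩
    convert q δ hd hd' using 1
    funext i
    refine Fin.lastCases ?_ (fun j => ?_) i <;> simp

/-- If a pp-formula holds of a tuple over `(ℚ; U₁, U₂, S₂)`, then the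
zero entries of the tuple can be simultaneously replaced by any sufficiently small
non-negative `δ` while still satisfying the formula. -/
theorem pp_zero_perturbation (k : ℕ) (φ : ALang.Formula (Fin k)) (hφ : IsPP φ)
    (a : Fin k → ℚ) (ha : φ.Realize a) :
    ∃ ε : ℚ, 0 < ε ∧ ∀ δ : ℚ, 0 ≤ δ → δ ≤ ε →
      φ.Realize (fun i => if a i = 0 then δ else a i) := by
  obtain ⟨ε, h0, h1⟩ := zeroPert_bounded hφ a _ ha
  refine ⟨ε, h0, fun δ hd hd' => ?_⟩
  have := h1 δ hd hd'
  unfold Formula.Realize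
  convert this using 1
  rfl

end PaperCSP
end

section
/- Consider the relational structure A = (ℚ; U₁, U₂, S₂), where U₁ = {x ∈ ℚ : x = 1}, U₂ = {x ∈ ℚ : x < 0}, and S₂ = {(x,y) ∈ ℚ² : 2x < y and 0 < y ≤ 1}. The unary relation {x ∈ ℚ : x ≤ 0} is first-order definable in A without parameters and is preserved by every ω-polymorphism of A, but it is not pp-definable in A without parameters; hence Inv(Pol^ω(A)) ∩ ⟨A⟩_fo ≠ ⟨A⟩_pp. -/
open FirstOrder FirstOrder.Language Cardinal

universe u v w

namespace PaperCSP

variable {L : FirstOrder.Language.{u, v}}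

/-- Replace `0` by `e`, fixing everything else. -/
def bump (e x : ℚ) : ℚ := if x = 0 then e else x

theorem term_bump {β : Type*} (e : ℚ) (v : β → ℚ) (t : ALang.Term β) :
    t.realize (bump e ∘ v) = bump e (t.realize v) := by
  cases t with
  | var _ => rfl
  | func f _ => exact (f : Empty).elim

theorem relMap_u1 (x : Fin 1 → ℚ) :
    Structure.RelMap (L := ALang) (M := ℚ) (ARel.u1 : ALang.Relations 1) x ↔ x 0 = 1 := Iff.rfl

theorem relMap_u2 (x : Fin 1 → ℚ) :
    Structure.RelMap (L := ALang) (M := ℚ) (ARel.u2 : ALang.Relations 1) x ↔ x 0 < 0 := Iff.rfl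

theorem relMap_s2 (x : Fin 2 → ℚ) :
    Structure.RelMap (L := ALang) (M := ℚ) (ARel.s2 : ALang.Relations 2) x ↔
      2 * x 0 < x 1 ∧ 0 < x 1 ∧ x 1 ≤ 1 := Iff.rfl

theorem rel_bump {l : ℕ} (R : ALang.Relations l) (x : Fin l → ℚ)
    (h : Structure.RelMap R x) :
    ∃ d : ℚ, 0 < d ∧ ∀ e, 0 < e → e < d → Structure.RelMap R (fun i => bump e (x i)) := by
  change ARel l at R
  cases R with
  | u1 =>
    refine ⟨1, one_pos, fun e _ _ => ?_⟩
    have h' : x 0 = 1 := h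
    change bump e (x 0) = 1
    simp [bump, h']
  | u2 =>
    refine ⟨1, one_pos, fun e _ _ => ?_⟩
    have h' : x 0 < 0 := h
    change bump e (x 0) < 0
    simp [bump, h', h'.ne]
  | s2 =>
    obtain ⟨h1, h2, h3⟩ : 2 * x 0 < x 1 ∧ 0 < x 1 ∧ x 1 ≤ 1 := h
    refine ⟨x 1 / 2, by linarith, fun e he hd => ?_⟩
    change 2 * bump e (x 0) < bump e (x 1) ∧ 0 < bump e (x 1) ∧ bump e (x 1) ≤ 1
    have hx : bump e (x 1) = x 1 := by simp [bump, h2.ne']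
    rw [hx]
    refine ⟨?_, h2, h3⟩
    unfold bump
    split_ifs <;> linarith

theorem pp_bump {α : Type*} {n : ℕ} {φ : ALang.BoundedFormula α n} (hφ : IsPP φ) :
    ∀ (v : α → ℚ) (xs : Fin n → ℚ), φ.Realize v xs →
      ∃ d : ℚ, 0 < d ∧ ∀ e, 0 < e → e < d → φ.Realize (bump e ∘ v) (bump e ∘ xs) := by
  induction hφ with
  | falsum => intro v xs h; exact h.elim
  | equal t₁ t₂ =>
    intro v xs h
    refine ⟨1, one_pos, fun e _ _ => ?_⟩
    have h' : t₁.realize (Sum.elim v xs) = t₂.realize (Sum.elim v xs) := h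
    change t₁.realize (Sum.elim (bump e ∘ v) (bump e ∘ xs)) =
      t₂.realize (Sum.elim (bump e ∘ v) (bump e ∘ xs))
    rw [← Sum.comp_elim, term_bump, term_bump, h']
  | rel R ts =>
    intro v xs h
    obtain ⟨d, hd, H⟩ := rel_bump R _ (show Structure.RelMap R
      (fun i => (ts i).realize (Sum.elim v xs)) from h)
    refine ⟨d, hd, fun e he hed => ?_⟩
    change Structure.RelMap R
      (fun i => (ts i).realize (Sum.elim (bump e ∘ v) (bump e ∘ xs)))
    simp only [← Sum.comp_elim, term_bump]
    exact H e he hed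
  | inf _ _ ih1 ih2 =>
    intro v xs h
    rw [BoundedFormula.realize_inf] at h
    obtain ⟨d1, hd1, H1⟩ := ih1 v xs h.1
    obtain ⟨d2, hd2, H2⟩ := ih2 v xs h.2
    refine ⟨min d1 d2, lt_min hd1 hd2, fun e he hed => ?_⟩
    rw [BoundedFormula.realize_inf]
    exact ⟨H1 e he (hed.trans_le (min_le_left _ _)), H2 e he (hed.trans_le (min_le_right _ _))⟩
  | ex _ ih =>
    intro v xs h
    rw [BoundedFormula.realize_ex] at h
    obtain ⟨a, ha⟩ := h
    obtain ⟨d, hd, H⟩ := ih v _ ha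
    refine ⟨d, hd, fun e he hed => ?_⟩
    rw [BoundedFormula.realize_ex]
    refine ⟨bump e a, ?_⟩
    have := H e he hed
    rwa [Fin.comp_snoc] at this

theorem not_pp : ¬ PPDefinable ALang ℚ {x : Fin 1 → ℚ | x 0 ≤ 0} := by
  rintro ⟨φ, hφ, hR⟩
  have h0 : (fun _ => 0 : Fin 1 → ℚ) ∈ {x : Fin 1 → ℚ | x 0 ≤ 0} := le_refl (0 : ℚ)
  rw [hR] at h0
  obtain ⟨d, hd, H⟩ := pp_bump hφ _ _ h0
  have h1 := H (d / 2) (by linarith) (by linarith)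
  have h2 : (bump (d / 2) ∘ fun _ => 0 : Fin 1 → ℚ) ∈ {x : Fin 1 → ℚ | x 0 ≤ 0} := by
    rw [hR]
    change BoundedFormula.Realize φ _ _
    convert h1 using 1
  have h3 : bump (d / 2) 0 ≤ 0 := h2
  simp only [bump, if_true] at h3
  linarith

theorem fo_def : FODefinable ALang ℚ {x : Fin 1 → ℚ | x 0 ≤ 0} := by
  let S : ALang.Relations 2 := ARel.s2
  let X : ALang.Term (Fin 1 ⊕ Fin 2) := Term.var (Sum.inl 0)
  let Y : ALang.Term (Fin 1 ⊕ Fin 2) := Term.var (Sum.inr 0)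
  let Z : ALang.Term (Fin 1 ⊕ Fin 2) := Term.var (Sum.inr 1)
  refine ⟨((BoundedFormula.rel S ![Z, Y]).imp (BoundedFormula.rel S ![X, Y])).all.all, ?_⟩
  ext x
  change x 0 ≤ 0 ↔ ∀ y z : ℚ, (2 * z < y ∧ 0 < y ∧ y ≤ 1) → (2 * x 0 < y ∧ 0 < y ∧ y ≤ 1)
  constructor
  · rintro h y z ⟨_, h2, h3⟩
    exact ⟨by linarith, h2, h3⟩
  · intro h
    by_contra! hx
    have := (h (min (x 0) 1) 0 ⟨by simp [hx], by simp [hx], min_le_right _ _⟩).1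
    have := min_le_left (x 0) 1
    linarith

theorem preserved : PreservedByOmegaPolymorphisms ALang ℚ {x : Fin 1 → ℚ | x 0 ≤ 0} := by
  intro I _ f a ha
  change f (a 0) ≤ 0
  replace ha : ∀ i, a 0 i ≤ 0 := ha
  have hS : ∀ p q : I → ℚ, (∀ i, 2 * p i < q i ∧ 0 < q i ∧ q i ≤ 1) →
      2 * f p < f q ∧ 0 < f q ∧ f q ≤ 1 := by
    intro p q h
    exact f.map_rel (ARel.s2 : ALang.Relations 2) ![p, q] h
  have hk : ∀ k : ℕ, f (fun _ => (1 / 3 : ℚ) ^ k) ≤ (1 / 2 : ℚ) ^ k := by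
    intro k
    induction k with
    | zero =>
      have : f (fun _ => (1 / 3 : ℚ) ^ 0) = 1 :=
        f.map_rel (ARel.u1 : ALang.Relations 1) ![fun _ => (1 / 3 : ℚ) ^ 0]
          (fun i => pow_zero (1 / 3 : ℚ))
      simpa using this.le
    | succ k ih =>
      have hp : (0 : ℚ) < (1 / 3) ^ k := by positivity
      have := (hS (fun _ => (1 / 3 : ℚ) ^ (k + 1)) (fun _ => (1 / 3 : ℚ) ^ k) (fun i =>
        ⟨by rw [pow_succ]; linarith, hp,
          pow_le_one₀ (by norm_num) (by norm_num)⟩)).1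
      rw [pow_succ (1 / 2 : ℚ)]
      linarith
  by_contra! hpos
  obtain ⟨k, hk'⟩ := exists_pow_lt_of_lt_one hpos (by norm_num : (1 / 2 : ℚ) < 1)
  have hp : (0 : ℚ) < (1 / 3) ^ k := by positivity
  have := (hS (a 0) (fun _ => (1 / 3 : ℚ) ^ k) (fun i =>
    ⟨by have := ha i; linarith, hp, pow_le_one₀ (by norm_num) (by norm_num)⟩)).1
  have := hk k
  linarith

/-- In `(ℚ; U₁, U₂, S₂)` the relation `x ≤ 0` is first-order definable
and preserved by all `ω`-polymorphisms, but not pp-definable; hence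
`Inv(Pol^ω(A)) ∩ ⟨A⟩_fo ≠ ⟨A⟩_pp`. -/
theorem leq_zero_fo_invariant_not_pp :
    FODefinable ALang ℚ {x : Fin 1 → ℚ | x 0 ≤ 0} ∧
    PreservedByOmegaPolymorphisms ALang ℚ {x : Fin 1 → ℚ | x 0 ≤ 0} ∧
    ¬ PPDefinable ALang ℚ {x : Fin 1 → ℚ | x 0 ≤ 0} ∧
    ¬ (∀ (m : ℕ) (R : Set (Fin m → ℚ)),
        (FODefinable ALang ℚ R ∧ PreservedByOmegaPolymorphisms ALang ℚ R)
          ↔ PPDefinable ALang ℚ R) := by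
  exact ⟨fo_def, preserved, not_pp, fun h => not_pp ((h 1 _).1 ⟨fo_def, preserved⟩)⟩

end PaperCSP
end
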